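/- arXiv:1211.4605 — 6 statements merged into one kernel-verified Lean document; each statement's English description precedes it below -/
import Mathlib

section
/- Let q ∈ (0,1), let H be a complex Hilbert space, and let (Z₁₁, Z₂₁, Z₂₂) be bounded operators on H satisfying the Pol(Mat₂^sym)_q relations which are irreducible, i.e. every bounded operator on H commuting with Z₁₁, Z₂₁, Z₂₂ and their adjoints is a scalar multiple of the identity. Then (Z₁₁, Z₂₁, Z₂₂) is unitarily equivalent (via a single unitary intertwining all three operators simultaneously) to exactly one representation from the following list: (1) a one-dimensional representation on ℂ given by Z₁₁ = q⁻¹e^{iψ}, Z₂₁ = 0, Z₂₂ = e^{iφ} for some ψ, φ ∈ ℝ/2πℤ; (2) a representation on ℓ²(ℤ₊) given by Z₁₁e_k = q⁻¹√(1−q^{4k+4}) e_{k+1}, Z₂₁ = 0, Z₂₂e_k = e^{iφ}e_k for some φ ∈ ℝ/2πℤ; (3) a representation on ℓ²(ℤ₊) given by Z₁₁e_k = −q⁻¹e^{2iφ}√(1−q^{4k}) e_{k−1} (with Z₁₁e₀ = 0), Z₂₁e_k = q^{2k}e^{iφ}e_k, Z₂₂e_k = √(1−q^{4k+4}) e_{k+1}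 for some φ ∈ ℝ/2πℤ; (4) a representation on ℓ²(ℤ₊²) given by Z₁₁e_{k,l} = q^{2k}e^{iφ}e_{k,l} − q⁻¹√((1−q^{4l})(1−q^{2k+2})(1−q^{2k+4})) e_{k+2,l−1}, Z₂₁e_{k,l} = q^{2l}√(1−q^{2k+2}) e_{k+1,l}, Z₂₂e_{k,l} = √(1−q^{4l+4}) e_{k,l+1} for some φ ∈ ℝ/2πℤ; or (5) the representation on ℓ²(ℤ₊³) given by Z₁₁e_{k,l,m} = q^{2l}√(1−q^{4m+4}) e_{k,l,m+1} − q⁻¹√((1−q^{4k})(1−q^{2l+2})(1−q^{2l+4})) e_{k−1,l+2,m}, Z₂₁e_{k,l,m} = q^{2k}√(1−q^{2l+2}) e_{k,l+1,m}, Z₂₂e_{k,l,m} = √(1−q^{4k+4}) e_{k+1,l,m}. (The phases on Z₁₁ follow the normalization of the paper's construction section.) -/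
open ContinuousLinearMap Complex

noncomputable section

/-- `ℓ²`-space over an index type, with complex coefficients. -/
abbrev L2 (ι : Type) [DecidableEq ι] : Type := lp (fun _ : ι => ℂ) 2

/-- The standard orthonormal basis vectors of `L2 ι`. -/
def e {ι : Type} [DecidableEq ι] (i : ι) : L2 ι := lp.single 2 i 1

/-- The defining relations of `Pol(Mat₂ˢʸᵐ)_q` for a triple of bounded operators
`Z₁₁, Z₂₁, Z₂₂` on a complex Hilbert space. -/
def PolMat2SymRel (q : ℝ) {H : Type} [NormedAddCommGroup H] [InnerProductSpace ℂ H]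
    [CompleteSpace H] (Z11 Z21 Z22 : H →L[ℂ] H) : Prop :=
  Z11 * Z21 = (q : ℂ) ^ 2 • (Z21 * Z11) ∧
  Z21 * Z22 = (q : ℂ) ^ 2 • (Z22 * Z21) ∧
  Z11 * Z22 - Z22 * Z11 = ((q : ℂ) * ((q : ℂ) ^ 2 - ((q : ℂ)⁻¹) ^ 2)) • (Z21 * Z21) ∧
  adjoint Z11 * Z11 =
      (q : ℂ) ^ 4 • (Z11 * adjoint Z11)
      - ((q : ℂ) * ((q : ℂ)⁻¹ - (q : ℂ)) * (1 + (q : ℂ) ^ 2) ^ 2) • (Z21 * adjoint Z21)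
      + (((q : ℂ)⁻¹ - (q : ℂ)) ^ 2 * (1 + (q : ℂ) ^ 2)) • (Z22 * adjoint Z22)
      + (1 - (q : ℂ) ^ 4) • (1 : H →L[ℂ] H) ∧
  adjoint Z11 * Z21 =
      (q : ℂ) ^ 2 • (Z21 * adjoint Z11)
      - ((q : ℂ) * ((q : ℂ)⁻¹ - (q : ℂ)) * ((q : ℂ)⁻¹ + (q : ℂ))) • (Z22 * adjoint Z21) ∧
  adjoint Z11 * Z22 = Z22 * adjoint Z11 ∧
  adjoint Z21 * Z22 = (q : ℂ) ^ 2 • (Z22 * adjoint Z21) ∧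
  adjoint Z21 * Z21 =
      (q : ℂ) ^ 2 • (Z21 * adjoint Z21) - (1 - (q : ℂ) ^ 2) • (Z22 * adjoint Z22)
      + (1 - (q : ℂ) ^ 2) • (1 : H →L[ℂ] H) ∧
  adjoint Z22 * Z22 = (q : ℂ) ^ 4 • (Z22 * adjoint Z22) + (1 - (q : ℂ) ^ 4) • (1 : H →L[ℂ] H)

/-- A family of bounded operators acts irreducibly if every bounded operator commuting with
all members of the family and with all their adjoints is a scalar multiple of the identity. -/
def IsIrreducibleFamily {H : Type} [NormedAddCommGroup H] [InnerProductSpace ℂ H]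
    [CompleteSpace H] (Z : Set (H →L[ℂ] H)) : Prop :=
  ∀ T : H →L[ℂ] H,
    (∀ A ∈ Z, T * A = A * T ∧ T * adjoint A = adjoint A * T) →
    ∃ c : ℂ, T = c • (1 : H →L[ℂ] H)

/-- `e^{iθ}` for an angle `θ ∈ ℝ/2πℤ`, as a complex number. -/
def aexp (θ : Real.Angle) : ℂ := (θ.toCircle : ℂ)

/-- A unitary `U` intertwines operators `Z` and `Z'`. -/
def Intertwines {H H' : Type} [NormedAddCommGroup H] [InnerProductSpace ℂ H]
    [NormedAddCommGroup H'] [InnerProductSpace ℂ H']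
    (U : H ≃ₗᵢ[ℂ] H') (Z : H →L[ℂ] H) (Z' : H' →L[ℂ] H') : Prop :=
  ∀ v : H, U (Z v) = Z' (U v)

/-- Labels for the five series of irreducible `*`-representations of `Pol(Mat₂ˢʸᵐ)_q`:
`π⁽¹⁾_{ψ,φ}` (two angle parameters), `π⁽²⁾_φ`, `π⁽³⁾_φ`, `π⁽⁴⁾_φ` (one angle parameter each)
and `π⁽⁵⁾` (no parameter). -/
abbrev RepLabel : Type :=
  (Real.Angle × Real.Angle) ⊕ Real.Angle ⊕ Real.Angle ⊕ Real.Angle ⊕ Unit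

/-- `(Z₁₁, Z₂₁, Z₂₂)` is unitarily equivalent (via a single unitary intertwining all three
operators simultaneously) to the model representation labelled by the given label. -/
def UnitarilyEquivToModel (q : ℝ) {H : Type} [NormedAddCommGroup H] [InnerProductSpace ℂ H]
    [CompleteSpace H] (Z11 Z21 Z22 : H →L[ℂ] H) : RepLabel → Prop
  -- (1) the one-dimensional representations `π⁽¹⁾_{ψ,φ}` on `ℂ`:
  --     `Z₁₁ = q⁻¹e^{iψ}`, `Z₂₁ = 0`, `Z₂₂ = e^{iφ}`
  | Sum.inl (ψ, φ) =>
      ∃ U : H ≃ₗᵢ[ℂ] ℂ,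
        Intertwines U Z11 (((q : ℂ)⁻¹ * aexp ψ) • (1 : ℂ →L[ℂ] ℂ)) ∧
        Intertwines U Z21 (0 : ℂ →L[ℂ] ℂ) ∧
        Intertwines U Z22 (aexp φ • (1 : ℂ →L[ℂ] ℂ))
  -- (2) `π⁽²⁾_φ` on `ℓ²(ℤ₊)`: `Z₁₁e_k = q⁻¹√(1−q^{4k+4})e_{k+1}`, `Z₂₁ = 0`, `Z₂₂ = e^{iφ}I`
  | Sum.inr (Sum.inl φ) =>
      ∃ Z11' : L2 ℕ →L[ℂ] L2 ℕ,
        (∀ k : ℕ, Z11' (e k) = ((q⁻¹ * Real.sqrt (1 - q ^ (4 * k + 4)) : ℝ) : ℂ) • e (k + 1)) ∧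
        ∃ U : H ≃ₗᵢ[ℂ] L2 ℕ,
          Intertwines U Z11 Z11' ∧
          Intertwines U Z21 (0 : L2 ℕ →L[ℂ] L2 ℕ) ∧
          Intertwines U Z22 (aexp φ • (1 : L2 ℕ →L[ℂ] L2 ℕ))
  -- (3) `π⁽³⁾_φ` on `ℓ²(ℤ₊)`: `Z₁₁e_k = −q⁻¹e^{2iφ}√(1−q^{4k})e_{k−1}` (coefficient vanishing
  --     at `k = 0`), `Z₂₁e_k = q^{2k}e^{iφ}e_k`, `Z₂₂e_k = √(1−q^{4k+4})e_{k+1}`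
  | Sum.inr (Sum.inr (Sum.inl φ)) =>
      ∃ Z11' Z21' Z22' : L2 ℕ →L[ℂ] L2 ℕ,
        (∀ k : ℕ, Z11' (e k) =
          (-(q : ℂ)⁻¹ * aexp (φ + φ) * ((Real.sqrt (1 - q ^ (4 * k)) : ℝ) : ℂ)) • e (k - 1)) ∧
        (∀ k : ℕ, Z21' (e k) = (((q ^ (2 * k) : ℝ) : ℂ) * aexp φ) • e k) ∧
        (∀ k : ℕ, Z22' (e k) = ((Real.sqrt (1 - q ^ (4 * k + 4)) : ℝ) : ℂ) • e (k + 1)) ∧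
        ∃ U : H ≃ₗᵢ[ℂ] L2 ℕ,
          Intertwines U Z11 Z11' ∧ Intertwines U Z21 Z21' ∧ Intertwines U Z22 Z22'
  -- (4) `π⁽⁴⁾_φ` on `ℓ²(ℤ₊²)`:
  --     `Z₁₁e_{k,l} = q^{2k}e^{iφ}e_{k,l} − q⁻¹√((1−q^{4l})(1−q^{2k+2})(1−q^{2k+4}))e_{k+2,l−1}`
  --     (second term vanishing at `l = 0`), `Z₂₁e_{k,l} = q^{2l}√(1−q^{2k+2})e_{k+1,l}`,
  --     `Z₂₂e_{k,l} = √(1−q^{4l+4})e_{k,l+1}`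
  | Sum.inr (Sum.inr (Sum.inr (Sum.inl φ))) =>
      ∃ Z11' Z21' Z22' : L2 (ℕ × ℕ) →L[ℂ] L2 (ℕ × ℕ),
        (∀ k l : ℕ, Z11' (e (k, l)) =
          (((q ^ (2 * k) : ℝ) : ℂ) * aexp φ) • e (k, l)
          - ((q⁻¹ * Real.sqrt ((1 - q ^ (4 * l)) * (1 - q ^ (2 * k + 2)) * (1 - q ^ (2 * k + 4)))
              : ℝ) : ℂ) • e (k + 2, l - 1)) ∧
        (∀ k l : ℕ, Z21' (e (k, l)) =
          ((q ^ (2 * l) * Real.sqrt (1 - q ^ (2 * k + 2)) : ℝ) : ℂ) • e (k + 1, l)) ∧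
        (∀ k l : ℕ, Z22' (e (k, l)) =
          ((Real.sqrt (1 - q ^ (4 * l + 4)) : ℝ) : ℂ) • e (k, l + 1)) ∧
        ∃ U : H ≃ₗᵢ[ℂ] L2 (ℕ × ℕ),
          Intertwines U Z11 Z11' ∧ Intertwines U Z21 Z21' ∧ Intertwines U Z22 Z22'
  -- (5) `π⁽⁵⁾` on `ℓ²(ℤ₊³)`:
  --     `Z₁₁e_{k,l,m} = q^{2l}√(1−q^{4m+4})e_{k,l,m+1}
  --        − q⁻¹√((1−q^{4k})(1−q^{2l+2})(1−q^{2l+4}))e_{k−1,l+2,m}`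
  --     (second term vanishing at `k = 0`), `Z₂₁e_{k,l,m} = q^{2k}√(1−q^{2l+2})e_{k,l+1,m}`,
  --     `Z₂₂e_{k,l,m} = √(1−q^{4k+4})e_{k+1,l,m}`
  | Sum.inr (Sum.inr (Sum.inr (Sum.inr _))) =>
      ∃ Z11' Z21' Z22' : L2 (ℕ × ℕ × ℕ) →L[ℂ] L2 (ℕ × ℕ × ℕ),
        (∀ k l m : ℕ, Z11' (e (k, l, m)) =
          ((q ^ (2 * l) * Real.sqrt (1 - q ^ (4 * m + 4)) : ℝ) : ℂ) • e (k, l, m + 1)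
          - ((q⁻¹ * Real.sqrt ((1 - q ^ (4 * k)) * (1 - q ^ (2 * l + 2)) * (1 - q ^ (2 * l + 4)))
              : ℝ) : ℂ) • e (k - 1, l + 2, m)) ∧
        (∀ k l m : ℕ, Z21' (e (k, l, m)) =
          ((q ^ (2 * k) * Real.sqrt (1 - q ^ (2 * l + 2)) : ℝ) : ℂ) • e (k, l + 1, m)) ∧
        (∀ k l m : ℕ, Z22' (e (k, l, m)) =
          ((Real.sqrt (1 - q ^ (4 * k + 4)) : ℝ) : ℂ) • e (k + 1, l, m)) ∧
        ∃ U : H ≃ₗᵢ[ℂ] L2 (ℕ × ℕ × ℕ),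
          Intertwines U Z11 Z11' ∧ Intertwines U Z21 Z21' ∧ Intertwines U Z22 Z22'

section HilbertSpace

variable {K : Type} [NormedAddCommGroup K] [InnerProductSpace ℂ K] [CompleteSpace K]

omit [CompleteSpace K] in
lemma inner_self_eq_ofReal (x : K) : inner ℂ x x = ((‖x‖ ^ 2 : ℝ) : ℂ) := by
  rw [inner_self_eq_norm_sq_to_K]; norm_cast

lemma norm_sq_of_oscillator {T : K →L[ℂ] K} {c : ℝ} {x : K}
    (h : adjoint T (T x) = (c : ℂ) • T (adjoint T x) + (1 - c : ℂ) • x) :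
    ‖T x‖ ^ 2 = c * ‖adjoint T x‖ ^ 2 + (1 - c) * ‖x‖ ^ 2 := by
  have h1 : inner ℂ x (adjoint T (T x)) = ((‖T x‖ ^ 2 : ℝ) : ℂ) := by
    rw [adjoint_inner_right, inner_self_eq_ofReal]
  have h2 : inner ℂ x (T (adjoint T x)) = ((‖adjoint T x‖ ^ 2 : ℝ) : ℂ) := by
    rw [← adjoint_inner_left, inner_self_eq_ofReal]
  rw [h, inner_add_right, inner_smul_right, inner_smul_right, h2, inner_self_eq_ofReal] at h1
  exact_mod_cast h1.symm

lemma opNorm_le_one_of_norm_sq_le {T : K →L[ℂ] K} {c : ℝ} (hc : c ∈ Set.Ioo (0 : ℝ) 1)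
    (h : ∀ x, ‖T x‖ ^ 2 ≤ c * ‖adjoint T x‖ ^ 2 + (1 - c) * ‖x‖ ^ 2) : ‖T‖ ≤ 1 := by
  obtain ⟨hc0, hc1⟩ := hc
  have hpos : 0 ≤ c * ‖T‖ ^ 2 + (1 - c) := by nlinarith [sq_nonneg ‖T‖]
  by_contra! hlt
  have hT0 : 0 < ‖T‖ := by linarith
  have key : ‖T‖ ≤ Real.sqrt (c * ‖T‖ ^ 2 + (1 - c)) := by
    refine T.opNorm_le_bound (Real.sqrt_nonneg _) fun x => ?_
    rw [← Real.sqrt_sq (norm_nonneg x), ← Real.sqrt_mul hpos]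
    refine Real.le_sqrt_of_sq_le ((h x).trans ?_)
    have h1 : ‖adjoint T x‖ ≤ ‖T‖ * ‖x‖ := by
      simpa using (adjoint T).le_opNorm x
    have h2 : ‖adjoint T x‖ ^ 2 ≤ (‖T‖ * ‖x‖) ^ 2 := by gcongr
    nlinarith
  have h3 := (Real.le_sqrt' hT0).1 key
  nlinarith [mul_pos (sub_pos.2 hc1) (sub_pos.2 hlt)]

lemma exists_fixed_of_pow {R : K →L[ℂ] K} {c : ℝ} (hc0 : 0 < c) (hc1 : c < 1)
    (hRsa : IsSelfAdjoint R) (hRne : R ≠ 0) (hR1 : ‖R‖ ≤ 1)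
    (hdiff : ∀ n : ℕ, ‖R ^ n - R ^ (n + 1)‖ ≤ c ^ n * ‖R ^ n‖) :
    ∃ P : K →L[ℂ] K, P ≠ 0 ∧ R * P = P := by
  have hRn (n : ℕ) : ‖R ^ n‖ ≤ 1 := by
    rcases Nat.eq_zero_or_pos n with rfl | hn
    · rw [pow_zero]
      exact norm_id_le
    · exact (norm_pow_le' R hn).trans (pow_le_one₀ (norm_nonneg _) hR1)
  have hcauchy : CauchySeq fun n => R ^ n := by
    refine cauchySeq_of_le_geometric c 1 hc1 fun n => ?_
    rw [dist_eq_norm]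
    refine (hdiff n).trans ?_
    rw [one_mul]
    exact mul_le_of_le_one_right (by positivity) (hRn n)
  obtain ⟨P, hP⟩ := cauchySeq_tendsto_of_complete hcauchy
  have hpow : Filter.Tendsto (fun k : ℕ => 2 ^ k) Filter.atTop Filter.atTop :=
    tendsto_pow_atTop_atTop_of_one_lt (by norm_num)
  have hRpos : 0 < ‖R‖ := norm_pos_iff.2 hRne
  have hstep (n : ℕ) (hn : 0 < ‖R ^ n‖) : 1 - c ^ n ≤ ‖R‖ := by
    have h2 : ‖R ^ (n + 1)‖ ≤ ‖R ^ n‖ * ‖R‖ := by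
      rw [pow_succ]; exact norm_mul_le _ _
    have h3 : ‖R ^ n‖ ≤ ‖R ^ n - R ^ (n + 1)‖ + ‖R ^ (n + 1)‖ := by
      simpa using norm_add_le (R ^ n - R ^ (n + 1)) (R ^ (n + 1))
    have h5 : (1 - c ^ n) * ‖R ^ n‖ ≤ ‖R‖ * ‖R ^ n‖ := by linarith [hdiff n]
    exact le_of_mul_le_mul_right h5 hn
  have hone : 1 ≤ ‖R‖ := by
    have hlim : Filter.Tendsto (fun k : ℕ => 1 - c ^ (2 ^ k)) Filter.atTop (nhds (1 - 0)) :=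
      ((tendsto_pow_atTop_nhds_zero_of_lt_one hc0.le hc1).comp hpow).const_sub 1
    rw [sub_zero] at hlim
    refine le_of_tendsto' hlim fun k => ?_
    refine hstep _ ?_
    rw [hRsa.norm_pow_two_pow]
    positivity
  have hPne : P ≠ 0 := by
    have hlim : Filter.Tendsto (fun k : ℕ => ‖R ^ (2 ^ k)‖) Filter.atTop (nhds ‖P‖) :=
      (hP.comp hpow).norm
    have h1 : 1 ≤ ‖P‖ := by
      refine ge_of_tendsto' hlim fun k => ?_
      rw [hRsa.norm_pow_two_pow]
      exact one_le_pow₀ hone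
    intro h0
    rw [h0, norm_zero] at h1
    linarith
  have hRP : R * P = P := by
    refine tendsto_nhds_unique (hP.const_mul R) ?_
    simpa [pow_succ'] using (Filter.tendsto_add_atTop_iff_nat 1).2 hP
  exact ⟨P, hPne, hRP⟩

/-- If `T` is a `c`-oscillator which is not unitary, then `adjoint T` has a nontrivial kernel. -/
lemma exists_vacuum {T : K →L[ℂ] K} {c : ℝ} (hc : c ∈ Set.Ioo (0 : ℝ) 1)
    (h : ∀ x, adjoint T (T x) = (c : ℂ) • T (adjoint T x) + (1 - c : ℂ) • x)
    (hne : ∃ x, T (adjoint T x) ≠ x) : ∃ v, v ≠ 0 ∧ adjoint T v = 0 := by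
  have hT : ‖T‖ ≤ 1 := opNorm_le_one_of_norm_sq_le hc fun x => (norm_sq_of_oscillator (h x)).le
  obtain ⟨hc0, hc1⟩ := hc
  have hT' : ‖adjoint T‖ ≤ 1 := by simpa using hT
  set R : K →L[ℂ] K := 1 - T * adjoint T with hR
  have hRsa : IsSelfAdjoint R := by
    rw [hR, ← star_eq_adjoint]
    exact (IsSelfAdjoint.one _).sub (IsSelfAdjoint.mul_star_self T)
  have hRne : R ≠ 0 := by
    obtain ⟨x, hx⟩ := hne
    intro h0
    apply hx
    have := congrArg (fun A : K →L[ℂ] K => A x) h0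
    simp [hR, sub_eq_zero] at this
    exact this.symm
  have hR1 : ‖R‖ ≤ 1 := by
    refine R.opNorm_le_bound zero_le_one fun x => ?_
    rw [one_mul]
    refine le_of_sq_le_sq ?_ (norm_nonneg _)
    have h1 : ‖T (adjoint T x)‖ ≤ ‖adjoint T x‖ := by
      simpa using T.le_of_opNorm_le hT (adjoint T x)
    have h2 : RCLike.re (inner ℂ x (T (adjoint T x))) = ‖adjoint T x‖ ^ 2 := by
      rw [← adjoint_inner_left]; exact inner_self_eq_norm_sq _
    have h3 : R x = x - T (adjoint T x) := by simp [hR]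
    rw [h3, @norm_sub_sq ℂ, h2]
    nlinarith [norm_nonneg (T (adjoint T x))]
  have hRT : R * T = (c : ℂ) • (T * R) := by
    ext x
    simp [hR, h, smul_sub]
    module
  have hRnT (n : ℕ) : R ^ n * T = ((c : ℂ) ^ n) • (T * R ^ n) := by
    induction n with
    | zero => simp
    | succ n ih =>
      rw [pow_succ, mul_assoc, hRT, mul_smul_comm, ← mul_assoc, ih, smul_mul_assoc, smul_smul,
        mul_assoc, pow_succ']
  have hdiff (n : ℕ) : ‖R ^ n - R ^ (n + 1)‖ ≤ c ^ n * ‖R ^ n‖ := by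
    have : R ^ n - R ^ (n + 1) = ((c : ℂ) ^ n) • (T * R ^ n * adjoint T) := by
      rw [← smul_mul_assoc, ← hRnT, pow_succ, ← mul_one_sub, hR, mul_assoc]; simp
    rw [this, norm_smul]
    have h1 : ‖T * R ^ n * adjoint T‖ ≤ 1 * ‖R ^ n‖ * 1 := by
      refine (norm_mul_le _ _).trans ?_
      refine mul_le_mul ((norm_mul_le _ _).trans ?_) hT' (norm_nonneg _) (by positivity)
      gcongr
    simp only [norm_pow, norm_real, Real.norm_eq_abs, abs_of_pos hc0]
    gcongr
    simpa using h1
  obtain ⟨P, hP0, hP⟩ := exists_fixed_of_pow hc0 hc1 hRsa hRne hR1 hdiff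
  obtain ⟨x, hx⟩ : ∃ x, P x ≠ 0 := by
    by_contra! h0
    exact hP0 (ext h0)
  refine ⟨P x, hx, ?_⟩
  have h1 : T (adjoint T (P x)) = 0 := by
    have := congrArg (fun A : K →L[ℂ] K => A x) hP
    simpa [hR] using this
  rw [← inner_self_eq_zero (𝕜 := ℂ), adjoint_inner_left, h1, inner_zero_right]

/-- The restriction of an operator to an invariant subspace. -/
def restrictTo (W : Submodule ℂ K) (T : K →L[ℂ] K) (hT : ∀ x ∈ W, T x ∈ W) : W →L[ℂ] W :=
  (T.comp W.subtypeL).codRestrict W fun x => hT x x.2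

omit [CompleteSpace K] in
@[simp]
lemma coe_restrictTo_apply {W : Submodule ℂ K} {T : K →L[ℂ] K} (hT : ∀ x ∈ W, T x ∈ W) (x : W) :
    (restrictTo W T hT x : K) = T x := rfl

lemma adjoint_restrictTo {W : Submodule ℂ K} [CompleteSpace W] {T : K →L[ℂ] K}
    (hT : ∀ x ∈ W, T x ∈ W) (hT' : ∀ x ∈ W, adjoint T x ∈ W) :
    adjoint (restrictTo W T hT) = restrictTo W (adjoint T) hT' := by
  symm
  rw [eq_adjoint_iff]
  intro x y
  simp [Submodule.coe_inner, adjoint_inner_left]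

lemma exists_vacuum_mem {W : Submodule ℂ K} (hW : IsClosed (W : Set K)) {T : K →L[ℂ] K} {c : ℝ}
    (hc : c ∈ Set.Ioo (0 : ℝ) 1) (hT : ∀ x ∈ W, T x ∈ W) (hT' : ∀ x ∈ W, adjoint T x ∈ W)
    (h : ∀ x ∈ W, adjoint T (T x) = (c : ℂ) • T (adjoint T x) + (1 - c : ℂ) • x)
    (hne : ∃ x ∈ W, T (adjoint T x) ≠ x) : ∃ v ∈ W, v ≠ 0 ∧ adjoint T v = 0 := by
  have : CompleteSpace W := hW.completeSpace_coe
  obtain ⟨v, hv0, hv⟩ := exists_vacuum (T := restrictTo W T hT) hc (fun x => by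
      rw [adjoint_restrictTo hT hT']
      exact Subtype.ext (h x x.2)) (by
      obtain ⟨x, hx, hxne⟩ := hne
      refine ⟨⟨x, hx⟩, fun h0 => hxne ?_⟩
      rw [adjoint_restrictTo hT hT'] at h0
      exact congrArg Subtype.val h0)
  rw [adjoint_restrictTo hT hT'] at hv
  exact ⟨v, v.2, by simpa using hv0, congrArg Subtype.val hv⟩

lemma exists_eq_smul_of_forall_invariant [Nontrivial K] {S : K →L[ℂ] K} (hS : IsStarNormal S)
    (h : ∀ N : Submodule ℂ K, IsClosed (N : Set K) → (∀ x ∈ N, S x ∈ N) →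
      (∀ x ∈ N, adjoint S x ∈ N) → N ≠ ⊥ → N = ⊤) : ∃ z : ℂ, ∀ x, S x = z • x := by
  obtain ⟨z, hz⟩ := spectrum.nonempty S
  refine ⟨z, fun x => ?_⟩
  suffices hs : spectrum ℂ S ⊆ {z} by
    rw [CFC.eq_algebraMap_of_spectrum_subset_singleton S z hs]
    simp [Algebra.algebraMap_eq_smul_one]
  intro w hw
  by_contra hwz
  have hwz' : w ≠ z := hwz
  set r : ℝ := ‖w - z‖ / 2 with hr
  have hrpos : 0 < r := by
    have := norm_pos_iff.2 (sub_ne_zero.2 hwz'); positivity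
  let f (a : ℂ) : ℂ → ℂ := fun u => ((max 0 (r - ‖u - a‖) : ℝ) : ℂ)
  have hf (a : ℂ) : Continuous (f a) := by fun_prop
  have hfa (a : ℂ) : f a a = (r : ℂ) := by simp [f, hrpos.le]
  have hne {a : ℂ} (ha : a ∈ spectrum ℂ S) : cfc (f a) S ≠ 0 := by
    intro h0
    have h1 : f a a ∈ spectrum ℂ (cfc (f a) S) := by
      rw [cfc_map_spectrum (f a) S (hf := (hf a).continuousOn)]
      exact ⟨a, ha, rfl⟩
    rw [h0, spectrum.zero_eq, hfa] at h1
    simp at h1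
    linarith
  have hmul : cfc (f w) S * cfc (f z) S = 0 := by
    rw [← cfc_mul (f w) (f z) S (hf w).continuousOn (hf z).continuousOn]
    have : (fun u => f w u * f z u) = fun _ => 0 := by
      funext u
      have h1 : ‖w - z‖ ≤ ‖u - w‖ + ‖u - z‖ := by
        rw [norm_sub_rev u w]; simpa using norm_add_le (w - u) (u - z)
      rcases le_total r ‖u - w‖ with h2 | h2
      · simp [f, max_eq_left (sub_nonpos.2 h2)]
      · have h3 : r ≤ ‖u - z‖ := by linarith
        simp [f, max_eq_left (sub_nonpos.2 h3)]
    rw [this, cfc_const_zero]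
  have hSn : Commute (star S) S := hS.star_comm_self
  have hc1 : Commute S (cfc (f w) S) :=
    (Commute.cfc (Commute.refl S) hSn (f w)).symm
  have hc2 : Commute (star S) (cfc (f w) S) :=
    (Commute.cfc hSn.symm (Commute.refl (star S)) (f w)).symm
  have hker := h (LinearMap.ker (cfc (f w) S).toLinearMap) (cfc (f w) S).isClosed_ker
    (fun x hx => by
      have : S (cfc (f w) S x) = cfc (f w) S (S x) := congrArg (fun A : K →L[ℂ] K => A x) hc1.eq
      have hx' : cfc (f w) S x = 0 := hx
      change cfc (f w) S (S x) = 0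
      rw [← this, hx', map_zero])
    (fun x hx => by
      have : adjoint S (cfc (f w) S x) = cfc (f w) S (adjoint S x) :=
        congrArg (fun A : K →L[ℂ] K => A x) hc2.eq
      have hx' : cfc (f w) S x = 0 := hx
      change cfc (f w) S (adjoint S x) = 0
      rw [← this, hx', map_zero])
    (fun h0 => hne hz (ext fun x => by
      have h1 : cfc (f z) S x ∈ LinearMap.ker (cfc (f w) S).toLinearMap := by
        change (cfc (f w) S * cfc (f z) S) x = 0
        rw [hmul]; rfl
      rw [h0] at h1
      exact h1))
  refine hne hw (ext fun x => ?_)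
  have : x ∈ LinearMap.ker (cfc (f w) S).toLinearMap := by rw [hker]; trivial
  exact this

/-- Schur's lemma for an operator acting unitarily on a closed invariant subspace. -/
lemma exists_aexp_eq {z : ℂ} (hz : ‖z‖ = 1) : ∃ θ : Real.Angle, aexp θ = z := by
  refine ⟨(arg z : ℝ), ?_⟩
  have := norm_mul_exp_arg_mul_I z
  rw [hz] at this
  simpa [aexp, Circle.coe_exp] using this

lemma exists_unit_eigenvector {W : Submodule ℂ K} (hW : IsClosed (W : Set K)) (hW0 : W ≠ ⊥)
    {S : K →L[ℂ] K} (hS : ∀ x ∈ W, S x ∈ W) (hS' : ∀ x ∈ W, adjoint S x ∈ W)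
    (h1 : ∀ x ∈ W, adjoint S (S x) = x) (h2 : ∀ x ∈ W, S (adjoint S x) = x)
    (h : ∀ N : Submodule ℂ K, N ≤ W → IsClosed (N : Set K) → (∀ x ∈ N, S x ∈ N) →
      (∀ x ∈ N, adjoint S x ∈ N) → N ≠ ⊥ → N = W) :
    ∃ (θ : Real.Angle) (v : K), v ∈ W ∧ ‖v‖ = 1 ∧ S v = aexp θ • v ∧
      adjoint S v = (aexp θ)⁻¹ • v := by
  have : CompleteSpace W := hW.completeSpace_coe
  have : Nontrivial W := (Submodule.nontrivial_iff_ne_bot).2 hW0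
  have hnormal : IsStarNormal (restrictTo W S hS) := by
    refine ⟨?_⟩
    rw [star_eq_adjoint, adjoint_restrictTo hS hS']
    ext x
    simp [h1 x x.2, h2 x x.2]
  obtain ⟨z, hz⟩ := exists_eq_smul_of_forall_invariant hnormal fun N hN hN1 hN2 hN0 => by
    rw [adjoint_restrictTo hS hS'] at hN2
    have hmap := h (N.map W.subtype) (by rintro _ ⟨x, -, rfl⟩; exact x.2)
      (by
        rw [Submodule.map_coe]
        exact hW.isClosedEmbedding_subtypeVal.isClosedMap _ hN)
      (by rintro _ ⟨x, hx, rfl⟩; exact ⟨_, hN1 x hx, rfl⟩)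
      (by rintro _ ⟨x, hx, rfl⟩; exact ⟨_, hN2 x hx, rfl⟩)
      (by
        intro h0
        apply hN0
        rw [eq_bot_iff]
        intro x hx
        have hx0 : (x : K) ∈ N.map W.subtype := ⟨x, hx, rfl⟩
        rw [h0] at hx0
        exact Subtype.ext hx0)
    rw [eq_top_iff]
    intro x _
    have hx : (x : K) ∈ N.map W.subtype := by rw [hmap]; exact x.2
    obtain ⟨y, hy, hyx⟩ := hx
    rwa [← Subtype.ext hyx]
  obtain ⟨v, hv⟩ := exists_norm_eq W zero_le_one
  have hSv : S v = z • (v : K) := congrArg Subtype.val (hz v)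
  have hv1 : ‖(v : K)‖ = 1 := hv
  have hz1 : ‖z‖ = 1 := by
    have h3 : inner ℂ (S v) (S v) = inner ℂ (v : K) (v : K) := by
      rw [← adjoint_inner_right, h1 v v.2]
    rw [inner_self_eq_ofReal, inner_self_eq_ofReal, hSv, norm_smul, hv1] at h3
    have h4 := Complex.ofReal_injective h3
    have := norm_nonneg z
    nlinarith
  obtain ⟨θ, hθ⟩ := exists_aexp_eq hz1
  refine ⟨θ, v, v.2, hv1, by rw [hθ, hSv], ?_⟩
  have hz0 : z ≠ 0 := by rintro rfl; simp at hz1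
  have h4 := h1 v v.2
  rw [hSv, map_smul] at h4
  rw [hθ, eq_inv_smul_iff₀ hz0, h4]

lemma eq_of_le_of_forall_orthogonal {N W : Submodule ℂ K} (hNW : N ≤ W)
    (hN : IsClosed (N : Set K)) (h : ∀ w ∈ W, (∀ n ∈ N, inner ℂ n w = 0) → w = 0) : N = W := by
  have : CompleteSpace N := hN.completeSpace_coe
  have h1 := Submodule.sup_orthogonal_inf_of_hasOrthogonalProjection hNW
  have h2 : Nᗮ ⊓ W = ⊥ := by
    rw [eq_bot_iff]
    rintro w ⟨hw, hwW⟩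
    exact h w hwW fun n hn => Submodule.inner_right_of_mem_orthogonal hn hw
  rw [h2, sup_bot_eq] at h1
  exact h1

lemma eq_zero_of_dense {G : Set K} (hG : (Submodule.span ℂ G).topologicalClosure = ⊤) {w : K}
    (h : ∀ g ∈ G, inner ℂ g w = 0) : w = 0 := by
  rw [Submodule.topologicalClosure_eq_top_iff] at hG
  have : w ∈ (Submodule.span ℂ G)ᗮ := by
    rw [Submodule.mem_orthogonal]
    intro u hu
    induction hu using Submodule.span_induction with
    | mem x hx => exact h x hx
    | zero => simp
    | add x y _ _ hx hy => rw [inner_add_left, hx, hy, add_zero]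
    | smul a x _ hx => rw [inner_smul_left, hx, mul_zero]
  rw [hG] at this
  exact this

/-- A nonzero set whose span is invariant under an irreducible family has dense span. -/
lemma IsIrreducibleFamily.span_dense {Z : Set (K →L[ℂ] K)} (hZ : IsIrreducibleFamily Z) {G : Set K}
    (hG0 : ∃ g ∈ G, g ≠ 0)
    (hG : ∀ A ∈ Z, ∀ g ∈ G, A g ∈ Submodule.span ℂ G ∧ adjoint A g ∈ Submodule.span ℂ G) :
    (Submodule.span ℂ G).topologicalClosure = ⊤ := by
  set M := (Submodule.span ℂ G).topologicalClosure with hM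
  have hGM : Submodule.span ℂ G ≤ M := Submodule.le_topologicalClosure _
  have : CompleteSpace M := (Submodule.isClosed_topologicalClosure _).completeSpace_coe
  have hinv (A : K →L[ℂ] K) (hA : ∀ g ∈ G, A g ∈ Submodule.span ℂ G) : ∀ x ∈ M, A x ∈ M := by
    intro x hx
    refine map_mem_closure A.continuous hx fun y hy => ?_
    have : Submodule.span ℂ G ≤ (Submodule.span ℂ G).comap A.toLinearMap :=
      Submodule.span_le.2 hA
    exact this hy
  have hcomm (A : K →L[ℂ] K) (h1 : ∀ x ∈ M, A x ∈ M) (h2 : ∀ x ∈ M, adjoint A x ∈ M) :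
      M.starProjection * A = A * M.starProjection := by
    ext x
    have hdec : A x = A (M.starProjection x) + A (x - M.starProjection x) := by simp
    have h3 : A (x - M.starProjection x) ∈ Mᗮ := by
      rw [Submodule.mem_orthogonal]
      intro u hu
      rw [← adjoint_inner_left]
      exact Submodule.inner_right_of_mem_orthogonal (h2 u hu)
        (Submodule.sub_starProjection_mem_orthogonal x)
    change M.starProjection (A x) = A (M.starProjection x)
    rw [hdec, map_add, (Submodule.starProjection_eq_self_iff).2
      (h1 _ (Submodule.starProjection_apply_mem M x)),
      (Submodule.starProjection_apply_eq_zero_iff M).2 h3, add_zero]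
  obtain ⟨c, hc⟩ := hZ M.starProjection fun A hA => by
    have h1 := hinv A fun g hg => (hG A hA g hg).1
    have h2 := hinv (adjoint A) fun g hg => (hG A hA g hg).2
    exact ⟨hcomm A h1 h2, hcomm (adjoint A) h2 (by rwa [adjoint_adjoint])⟩
  obtain ⟨g, hg, hg0⟩ := hG0
  have hgM : g ∈ M := hGM (Submodule.subset_span hg)
  have hPg := (Submodule.starProjection_eq_self_iff (K := M)).2 hgM
  rw [hc] at hPg
  have hc1 : c = 1 := by
    have h0 : (c - 1) • g = 0 := by rw [sub_smul, one_smul, sub_eq_zero]; simpa using hPg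
    simpa [sub_eq_zero, hg0] using h0
  rw [eq_top_iff]
  intro x _
  rw [← Submodule.starProjection_eq_self_iff, hc, hc1]
  simp

/-- An orthonormal family with dense span gives a unitary onto `L2` matching the bases. -/
lemma exists_unitary_of_orthonormal {ι : Type} [DecidableEq ι] {x : ι → K} (hx : Orthonormal ℂ x)
    (hd : (Submodule.span ℂ (Set.range x)).topologicalClosure = ⊤) :
    ∃ U : K ≃ₗᵢ[ℂ] L2 ι, ∀ i, U (x i) = e i := by
  refine ⟨(HilbertBasis.mk hx hd.ge).repr, fun i => ?_⟩
  have := (HilbertBasis.mk hx hd.ge).repr_self i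
  rwa [HilbertBasis.coe_mk] at this

/-- Transport of an operator along a unitary. -/
def transport {K' : Type} [NormedAddCommGroup K'] [InnerProductSpace ℂ K'] (U : K ≃ₗᵢ[ℂ] K')
    (A : K →L[ℂ] K) : K' →L[ℂ] K' :=
  (U.toContinuousLinearEquiv : K →L[ℂ] K').comp
    (A.comp (U.symm.toContinuousLinearEquiv : K' →L[ℂ] K))

omit [CompleteSpace K] in
lemma transport_apply {K' : Type} [NormedAddCommGroup K'] [InnerProductSpace ℂ K']
    (U : K ≃ₗᵢ[ℂ] K') (A : K →L[ℂ] K) (x : K) : transport U A (U x) = U (A x) := by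
  simp [transport]

omit [CompleteSpace K] in
lemma intertwines_transport {K' : Type} [NormedAddCommGroup K'] [InnerProductSpace ℂ K']
    (U : K ≃ₗᵢ[ℂ] K') (A : K →L[ℂ] K) : Intertwines U A (transport U A) :=
  fun x => (transport_apply U A x).symm

end HilbertSpace

section Oscillator

variable {K : Type} [NormedAddCommGroup K] [InnerProductSpace ℂ K]

lemma pow_succ_apply (T : K →L[ℂ] K) (k : ℕ) (x : K) : (T ^ (k + 1)) x = T ((T ^ k) x) := by
  rw [pow_succ']; rfl

lemma pow_apply_mem {T : K →L[ℂ] K} {W : Set K} (hT : ∀ x ∈ W, T x ∈ W) {x : K} (hx : x ∈ W)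
    (k : ℕ) : (T ^ k) x ∈ W := by
  induction k with
  | zero => exact hx
  | succ k ih => rw [pow_succ_apply]; exact hT _ ih

lemma apply_pow_of_commute {D T : K →L[ℂ] K} {a : ℂ} (h : ∀ x, D (T x) = a • T (D x))
    (k : ℕ) (x : K) : D ((T ^ k) x) = a ^ k • (T ^ k) (D x) := by
  induction k with
  | zero => simp
  | succ k ih => rw [pow_succ_apply, pow_succ_apply, h, ih, map_smul, smul_smul, pow_succ']

/-- The normalised powers of a `c`-oscillator, mapping the vacuum to the `k`-th level. -/
def osc (c : ℝ) (T : K →L[ℂ] K) (k : ℕ) : K →L[ℂ] K :=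
  ((∏ j ∈ Finset.range k, Real.sqrt (1 - c ^ (j + 1)) : ℝ) : ℂ)⁻¹ • T ^ k

lemma sqrt_one_sub_pow_pos {c : ℝ} (hc : c ∈ Set.Ioo (0 : ℝ) 1) (k : ℕ) :
    0 < Real.sqrt (1 - c ^ (k + 1)) :=
  Real.sqrt_pos.2 (sub_pos.2 (pow_lt_one₀ hc.1.le hc.2 k.succ_ne_zero))

lemma osc_zero (c : ℝ) (T : K →L[ℂ] K) (x : K) : osc c T 0 x = x := by simp [osc]

lemma apply_osc {c : ℝ} (hc : c ∈ Set.Ioo (0 : ℝ) 1) (T : K →L[ℂ] K) (k : ℕ) (x : K) :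
    T (osc c T k x) = (Real.sqrt (1 - c ^ (k + 1)) : ℂ) • osc c T (k + 1) x := by
  have h := (sqrt_one_sub_pow_pos hc k).ne'
  have h' : (Real.sqrt (1 - c ^ (k + 1)) : ℂ) ≠ 0 := by exact_mod_cast h
  simp only [osc, smul_apply, map_smul, Finset.prod_range_succ, pow_succ_apply, smul_smul]
  congr 1
  push_cast
  rw [mul_inv, mul_comm, mul_assoc, inv_mul_cancel₀ h', mul_one]

lemma osc_succ {c : ℝ} (hc : c ∈ Set.Ioo (0 : ℝ) 1) (T : K →L[ℂ] K) (k : ℕ) (x : K) :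
    osc c T (k + 1) x = (Real.sqrt (1 - c ^ (k + 1)) : ℂ)⁻¹ • T (osc c T k x) := by
  have h := (sqrt_one_sub_pow_pos hc k).ne'
  rw [apply_osc hc, inv_smul_smul₀ (by exact_mod_cast h)]

lemma apply_osc_of_commute {D T : K →L[ℂ] K} {a : ℂ} (h : ∀ x, D (T x) = a • T (D x))
    (c : ℝ) (k : ℕ) (x : K) : D (osc c T k x) = a ^ k • osc c T k (D x) := by
  simp only [osc, smul_apply, map_smul, apply_pow_of_commute h, smul_smul, mul_comm]

lemma pow_eq_smul_osc {c : ℝ} (hc : c ∈ Set.Ioo (0 : ℝ) 1) (T : K →L[ℂ] K) (k : ℕ) :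
    ∃ a : ℂ, T ^ k = a • osc c T k := by
  refine ⟨((∏ j ∈ Finset.range k, Real.sqrt (1 - c ^ (j + 1)) : ℝ) : ℂ), ?_⟩
  have h : (∏ j ∈ Finset.range k, Real.sqrt (1 - c ^ (j + 1)) : ℝ) ≠ 0 :=
    Finset.prod_ne_zero_iff.2 fun j _ => (sqrt_one_sub_pow_pos hc j).ne'
  rw [osc, smul_inv_smul₀ (by exact_mod_cast h)]

variable [CompleteSpace K]

/-- `T` satisfies the `c`-oscillator relation on the invariant set `W`. -/
structure IsOscillatorOn (c : ℝ) (T : K →L[ℂ] K) (W : Set K) : Prop where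
  mem : ∀ x ∈ W, T x ∈ W
  rel : ∀ x ∈ W, adjoint T (T x) = (c : ℂ) • T (adjoint T x) + (1 - c : ℂ) • x

namespace IsOscillatorOn

variable {c : ℝ} {T : K →L[ℂ] K} {W : Set K}

lemma adjoint_pow_succ (h : IsOscillatorOn c T W) {v : K} (hv : v ∈ W) (hv0 : adjoint T v = 0)
    (k : ℕ) : adjoint T ((T ^ (k + 1)) v) = (1 - (c : ℂ) ^ (k + 1)) • (T ^ k) v := by
  induction k with
  | zero => simp [h.rel v hv, hv0]
  | succ k ih =>
    rw [pow_succ_apply, h.rel _ (pow_apply_mem h.mem hv _), ih, map_smul, ← pow_succ_apply]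
    module

lemma adjoint_osc_succ (hc : c ∈ Set.Ioo (0 : ℝ) 1) (h : IsOscillatorOn c T W) {v : K}
    (hv : v ∈ W) (hv0 : adjoint T v = 0) (k : ℕ) :
    adjoint T (osc c T (k + 1) v) = (Real.sqrt (1 - c ^ (k + 1)) : ℂ) • osc c T k v := by
  have hs := sqrt_one_sub_pow_pos hc k
  have hs' : (Real.sqrt (1 - c ^ (k + 1)) : ℂ) ≠ 0 := by exact_mod_cast hs.ne'
  have hsq : (1 - (c : ℂ) ^ (k + 1)) = (Real.sqrt (1 - c ^ (k + 1)) : ℂ) ^ 2 := by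
    exact_mod_cast (Real.sq_sqrt (Real.sqrt_pos.1 hs).le).symm
  simp only [osc, smul_apply, map_smul, Finset.prod_range_succ, h.adjoint_pow_succ hv hv0,
    smul_smul, hsq]
  congr 1
  push_cast
  field_simp

lemma inner_osc (hc : c ∈ Set.Ioo (0 : ℝ) 1) (h : IsOscillatorOn c T W) {u v : K}
    (hu0 : adjoint T u = 0) (hv : v ∈ W) (hv0 : adjoint T v = 0) (k l : ℕ) :
    inner ℂ (osc c T k u) (osc c T l v) = if k = l then inner ℂ u v else 0 := by
  induction k generalizing l with
  | zero =>
    cases l with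
    | zero => simp [osc_zero]
    | succ l =>
      rw [osc_zero, osc_succ hc, inner_smul_right, ← adjoint_inner_left, hu0, inner_zero_left]
      simp
  | succ k ih =>
    rw [osc_succ hc, inner_smul_left, ← adjoint_inner_right]
    cases l with
    | zero => simp [osc_zero, hv0]
    | succ l =>
      rw [h.adjoint_osc_succ hc hv hv0, inner_smul_right, ih]
      have hs' : (Real.sqrt (1 - c ^ (k + 1)) : ℂ) ≠ 0 := by
        exact_mod_cast (sqrt_one_sub_pow_pos hc k).ne'
      by_cases hkl : k = l
      · subst hkl
        simp [hs']
      · simp [hkl]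

end IsOscillatorOn

end Oscillator

section Relations

variable {K : Type} [NormedAddCommGroup K] [InnerProductSpace ℂ K] [CompleteSpace K]

/-- The relations of `Pol(Mat₂ˢʸᵐ)_q` and their adjoints, evaluated at vectors. -/
structure PointwiseRel (q : ℝ) (A B C : K →L[ℂ] K) : Prop where
  AB : ∀ x, A (B x) = (q : ℂ) ^ 2 • B (A x)
  BC : ∀ x, B (C x) = (q : ℂ) ^ 2 • C (B x)
  AC : ∀ x, A (C x) = C (A x) - ((q : ℂ)⁻¹ * (1 - (q : ℂ) ^ 4)) • B (B x)
  A'A : ∀ x, adjoint A (A x) = (q : ℂ) ^ 4 • A (adjoint A x)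
    - ((q : ℂ) * ((q : ℂ)⁻¹ - (q : ℂ)) * (1 + (q : ℂ) ^ 2) ^ 2) • B (adjoint B x)
    + (((q : ℂ)⁻¹ - (q : ℂ)) ^ 2 * (1 + (q : ℂ) ^ 2)) • C (adjoint C x)
    + (1 - (q : ℂ) ^ 4) • x
  A'B : ∀ x, adjoint A (B x) = (q : ℂ) ^ 2 • B (adjoint A x)
    - ((q : ℂ)⁻¹ * (1 - (q : ℂ) ^ 4)) • C (adjoint B x)
  A'C : ∀ x, adjoint A (C x) = C (adjoint A x)
  B'C : ∀ x, adjoint B (C x) = (q : ℂ) ^ 2 • C (adjoint B x)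
  B'B : ∀ x, adjoint B (B x) = (q : ℂ) ^ 2 • B (adjoint B x)
    - (1 - (q : ℂ) ^ 2) • C (adjoint C x) + (1 - (q : ℂ) ^ 2) • x
  C'C : ∀ x, adjoint C (C x) = (q : ℂ) ^ 4 • C (adjoint C x) + (1 - (q : ℂ) ^ 4) • x
  B'A' : ∀ x, adjoint B (adjoint A x) = (q : ℂ) ^ 2 • adjoint A (adjoint B x)
  C'B' : ∀ x, adjoint C (adjoint B x) = (q : ℂ) ^ 2 • adjoint B (adjoint C x)
  C'A' : ∀ x, adjoint C (adjoint A x) = adjoint A (adjoint C x)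
    - ((q : ℂ)⁻¹ * (1 - (q : ℂ) ^ 4)) • adjoint B (adjoint B x)
  B'A : ∀ x, adjoint B (A x) = (q : ℂ) ^ 2 • A (adjoint B x)
    - ((q : ℂ)⁻¹ * (1 - (q : ℂ) ^ 4)) • B (adjoint C x)
  C'A : ∀ x, adjoint C (A x) = A (adjoint C x)
  C'B : ∀ x, adjoint C (B x) = (q : ℂ) ^ 2 • B (adjoint C x)

lemma PolMat2SymRel.pointwise {q : ℝ} (hq : q ≠ 0) {A B C : K →L[ℂ] K}
    (h : PolMat2SymRel q A B C) : PointwiseRel q A B C := by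
  obtain ⟨h1, h2, h3, h4, h5, h6, h7, h8, h9⟩ := h
  have hq' : (q : ℂ) ≠ 0 := by exact_mod_cast hq
  have e3 : (q : ℂ) * ((q : ℂ) ^ 2 - ((q : ℂ)⁻¹) ^ 2) = -((q : ℂ)⁻¹ * (1 - (q : ℂ) ^ 4)) := by
    field_simp; ring
  have e5 : (q : ℂ) * ((q : ℂ)⁻¹ - (q : ℂ)) * ((q : ℂ)⁻¹ + (q : ℂ)) =
      (q : ℂ)⁻¹ * (1 - (q : ℂ) ^ 4) := by
    field_simp; ring
  rw [e3, sub_eq_iff_eq_add', neg_smul, ← sub_eq_add_neg] at h3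
  rw [e5] at h5
  have ev {X Y : K →L[ℂ] K} (hXY : X = Y) (x : K) : X x = Y x := by rw [hXY]
  have evs {X Y : K →L[ℂ] K} (hXY : X = Y) (x : K) : (star X) x = (star Y) x := by rw [hXY]
  refine ⟨ev h1, ev h2, ev h3, ev h4, ev h5, ev h6, ev h7, ev h8, ev h9, fun x => ?_, fun x => ?_,
    fun x => ?_, fun x => ?_, fun x => ?_, fun x => ?_⟩
  · simpa [star_smul, star_mul, star_eq_adjoint] using evs h1 x
  · simpa [star_smul, star_mul, star_eq_adjoint] using evs h2 x
  · have := evs h3 x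
    simp [star_smul, star_mul, star_sub, star_eq_adjoint] at this
    rw [mul_comm ((q : ℂ)⁻¹)]
    exact this
  · have := evs h5 x
    simp [star_smul, star_mul, star_sub, star_eq_adjoint] at this
    rw [mul_comm ((q : ℂ)⁻¹)]
    exact this
  · have := evs h6 x
    simp [star_mul, star_eq_adjoint] at this
    exact this
  · have := evs h7 x
    simp [star_smul, star_mul, star_eq_adjoint] at this
    exact this

namespace PointwiseRel

variable {q : ℝ} {A B C : K →L[ℂ] K}

lemma isOscillatorOn_C (h : PointwiseRel q A B C) : IsOscillatorOn (q ^ 4) C Set.univ :=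
  ⟨fun _ _ => trivial, fun x _ => by simpa using h.C'C x⟩

lemma isOscillatorOn_B (h : PointwiseRel q A B C) :
    IsOscillatorOn (q ^ 2) B {x | adjoint C x = 0} := by
  refine ⟨fun x hx => ?_, fun x hx => ?_⟩
  · have hx' : adjoint C x = 0 := hx
    simp [h.C'B, hx']
  · have hx' : adjoint C x = 0 := hx
    simpa [hx'] using h.B'B x

lemma isOscillatorOn_A (h : PointwiseRel q A B C) :
    IsOscillatorOn (q ^ 4) A {x | adjoint C x = 0 ∧ adjoint B x = 0} := by
  refine ⟨fun x hx => ?_, fun x hx => ?_⟩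
  · obtain ⟨hx1, hx2⟩ := hx
    simp [h.C'A, h.B'A, hx1, hx2]
  · obtain ⟨hx1, hx2⟩ := hx
    simpa [hx1, hx2] using h.A'A x

lemma adjoint_A_mem (h : PointwiseRel q A B C) {x : K} (hC : adjoint C x = 0)
    (hB : adjoint B x = 0) : adjoint C (adjoint A x) = 0 ∧ adjoint B (adjoint A x) = 0 := by
  simp [h.C'A', h.B'A', hC, hB]

lemma adjoint_B_mem (h : PointwiseRel q A B C) {x : K} (hC : adjoint C x = 0) :
    adjoint C (adjoint B x) = 0 := by
  simp [h.C'B', hC]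

lemma A_C_pow (h : PointwiseRel q A B C) (k : ℕ) (x : K) :
    A ((C ^ k) x) = (C ^ k) (A x)
      - ((q : ℂ)⁻¹ * (1 - (q : ℂ) ^ (4 * k))) • (C ^ (k - 1)) (B (B x)) := by
  induction k with
  | zero => simp
  | succ k ih =>
    rw [pow_succ_apply, h.AC, ih, apply_pow_of_commute h.BC, map_smul, apply_pow_of_commute h.BC]
    cases k with
    | zero => simp
    | succ k =>
      simp only [map_sub, map_smul, Nat.add_sub_cancel, ← pow_succ_apply, smul_smul]
      module

lemma adjoint_A_B_pow (h : PointwiseRel q A B C) {u : K} (hC : adjoint C u = 0)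
    (hB : adjoint B u = 0) (l : ℕ) : ∃ a : ℂ, adjoint A ((B ^ (l + 2)) u) =
      (q : ℂ) ^ (2 * (l + 2)) • (B ^ (l + 2)) (adjoint A u) + a • C ((B ^ l) u) := by
  have hB1 (l : ℕ) := h.isOscillatorOn_B.adjoint_pow_succ hC hB l
  induction l with
  | zero =>
    refine ⟨-((q : ℂ)⁻¹ * (1 - (q : ℂ) ^ 4)) * (1 - (q : ℂ) ^ 2), ?_⟩
    have h1 := hB1 0
    rw [pow_succ_apply, h.A'B, hB1 0]
    simp only [zero_add, pow_one, pow_zero, map_smul, h.A'B, hB, map_zero, smul_zero,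
      sub_zero, pow_succ_apply B 1]
    push_cast
    module
  | succ l ih =>
    obtain ⟨a, ha⟩ := ih
    refine ⟨(q : ℂ) ^ 4 * a - ((q : ℂ)⁻¹ * (1 - (q : ℂ) ^ 4)) * (1 - ((q : ℂ) ^ 2) ^ (l + 2)), ?_⟩
    rw [show l + 1 + 2 = (l + 2) + 1 by ring, pow_succ_apply, h.A'B, ha, hB1 (l + 1)]
    simp only [map_add, map_smul, h.BC, pow_succ_apply B (l + 2), pow_succ_apply B l]
    push_cast
    module

lemma norm_B_le (hq : q ∈ Set.Ioo (0 : ℝ) 1) (h : PointwiseRel q A B C) : ‖B‖ ≤ 1 := by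
  have hq2 : q ^ 2 ∈ Set.Ioo (0 : ℝ) 1 := ⟨pow_pos hq.1 2, pow_lt_one₀ hq.1.le hq.2 two_ne_zero⟩
  refine opNorm_le_one_of_norm_sq_le hq2 fun x => ?_
  have h1 : inner ℂ x (adjoint B (B x)) = ((‖B x‖ ^ 2 : ℝ) : ℂ) := by
    rw [adjoint_inner_right, inner_self_eq_ofReal]
  have h2 : inner ℂ x (B (adjoint B x)) = ((‖adjoint B x‖ ^ 2 : ℝ) : ℂ) := by
    rw [← adjoint_inner_left, inner_self_eq_ofReal]
  have h3 : inner ℂ x (C (adjoint C x)) = ((‖adjoint C x‖ ^ 2 : ℝ) : ℂ) := by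
    rw [← adjoint_inner_left, inner_self_eq_ofReal]
  rw [h.B'B, inner_add_right, inner_sub_right, inner_smul_right, inner_smul_right,
    inner_smul_right, h2, h3, inner_self_eq_ofReal] at h1
  have h4 : q ^ 2 * ‖adjoint B x‖ ^ 2 - (1 - q ^ 2) * ‖adjoint C x‖ ^ 2 + (1 - q ^ 2) * ‖x‖ ^ 2
      = ‖B x‖ ^ 2 := by exact_mod_cast h1
  nlinarith [mul_nonneg (sub_nonneg.2 hq2.2.le) (sq_nonneg ‖adjoint C x‖)]

/-- An operator which is contracted by conjugation with the unitary part of `B` vanishes. -/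
lemma eq_zero_of_conj (hq : q ∈ Set.Ioo (0 : ℝ) 1) (hB : ‖B‖ ≤ 1) {W : Submodule ℂ K}
    (hW : ∀ x ∈ W, adjoint B x ∈ W) {F : K →L[ℂ] K}
    (hF : ∀ x ∈ W, F x = (q : ℂ) ^ 2 • B (F (adjoint B x))) : ∀ x ∈ W, F x = 0 := by
  have hB' : ‖adjoint B‖ ≤ 1 := by simpa using hB
  set G : W →L[ℂ] K := F.comp W.subtypeL with hG
  have hGle : ‖G‖ ≤ q ^ 2 * ‖G‖ := by
    refine G.opNorm_le_bound (by positivity) fun x => ?_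
    have h1 : G x = (q : ℂ) ^ 2 • B (G ⟨adjoint B x, hW x x.2⟩) := hF x x.2
    rw [h1, norm_smul]
    have h2 : ‖B (G ⟨adjoint B x, hW x x.2⟩)‖ ≤ ‖G ⟨adjoint B x, hW x x.2⟩‖ := by
      simpa using B.le_of_opNorm_le hB (G ⟨adjoint B x, hW x x.2⟩)
    have h3 : ‖(⟨adjoint B x, hW x x.2⟩ : W)‖ ≤ ‖x‖ := by
      simpa using (adjoint B).le_of_opNorm_le hB' (x : K)
    have h4 := G.le_opNorm ⟨adjoint B x, hW x x.2⟩
    have h5 : ‖(q : ℂ) ^ 2‖ = q ^ 2 := by simp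
    rw [h5, mul_assoc]
    gcongr
    exact h2.trans (h4.trans (by gcongr))
  have hq2 : q ^ 2 < 1 := pow_lt_one₀ hq.1.le hq.2 two_ne_zero
  have hG0 : ‖G‖ = 0 := by nlinarith [norm_nonneg G]
  intro x hx
  have hGx := G.le_opNorm ⟨x, hx⟩
  rw [hG0, zero_mul, norm_le_zero_iff] at hGx
  exact hGx

lemma A_osc_C (hq : q ∈ Set.Ioo (0 : ℝ) 1) (h : PointwiseRel q A B C) (k : ℕ) (x : K) :
    A (osc (q ^ 4) C k x) = osc (q ^ 4) C k (A x)
      - ((q⁻¹ * Real.sqrt (1 - q ^ (4 * k)) : ℝ) : ℂ) • osc (q ^ 4) C (k - 1) (B (B x)) := by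
  have hq4 : q ^ 4 ∈ Set.Ioo (0 : ℝ) 1 := ⟨pow_pos hq.1 4, pow_lt_one₀ hq.1.le hq.2 four_ne_zero⟩
  cases k with
  | zero => simp [osc_zero]
  | succ k =>
    have hs := sqrt_one_sub_pow_pos hq4 k
    rw [← pow_mul] at hs
    have hs' : (Real.sqrt (1 - q ^ (4 * (k + 1))) : ℂ) ≠ 0 := by exact_mod_cast hs.ne'
    have hsq : 1 - (q : ℂ) ^ (4 * (k + 1)) = (Real.sqrt (1 - q ^ (4 * (k + 1))) : ℂ) ^ 2 := by
      exact_mod_cast (Real.sq_sqrt (Real.sqrt_pos.1 hs).le).symm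
    simp only [osc, smul_apply, map_smul, h.A_C_pow, Finset.prod_range_succ, smul_sub, smul_smul,
      Nat.add_sub_cancel, ← pow_mul, hsq]
    congr 2
    push_cast
    field_simp

end PointwiseRel

end Relations

section Density

variable {K : Type} [NormedAddCommGroup K] [InnerProductSpace ℂ K] [CompleteSpace K]

omit [CompleteSpace K] in
lemma pow_succ_apply' (T : K →L[ℂ] K) (k : ℕ) (x : K) : (T ^ (k + 1)) x = (T ^ k) (T x) := by
  rw [pow_succ]; rfl

namespace PointwiseRel

variable {q : ℝ} {A B C : K →L[ℂ] K}

lemma span_C_pow_B_pow_dense (h : PointwiseRel q A B C) (hirr : IsIrreducibleFamily {A, B, C})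
    {N : Submodule ℂ K} (hC : ∀ n ∈ N, adjoint C n = 0) (hB : ∀ n ∈ N, adjoint B n = 0)
    (hA : ∀ n ∈ N, A n ∈ N) (hA' : ∀ n ∈ N, adjoint A n ∈ N) (hN : N ≠ ⊥) :
    (Submodule.span ℂ {x | ∃ k l : ℕ, ∃ n ∈ N, x = (C ^ k) ((B ^ l) n)}).topologicalClosure
      = ⊤ := by
  set G : Set K := {x | ∃ k l : ℕ, ∃ n ∈ N, x = (C ^ k) ((B ^ l) n)} with hG
  have mem (k l : ℕ) {n : K} (hn : n ∈ N) : (C ^ k) ((B ^ l) n) ∈ Submodule.span ℂ G :=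
    Submodule.subset_span ⟨k, l, n, hn, rfl⟩
  have hCB (l : ℕ) {n : K} (hn : n ∈ N) : adjoint C ((B ^ l) n) = 0 := by
    rw [apply_pow_of_commute h.C'B, hC n hn, map_zero, smul_zero]
  refine hirr.span_dense ?_ ?_
  · obtain ⟨n, hn, hn0⟩ := N.exists_mem_ne_zero_of_ne_bot hN
    exact ⟨n, ⟨0, 0, n, hn, rfl⟩, hn0⟩
  · rintro T (rfl | rfl | rfl) _ ⟨k, l, n, hn, rfl⟩
    · constructor
      · rw [h.A_C_pow, apply_pow_of_commute h.AB, map_smul, ← pow_succ_apply, ← pow_succ_apply]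
        exact sub_mem (Submodule.smul_mem _ _ (mem _ _ (hA n hn)))
          (Submodule.smul_mem _ _ (mem _ _ hn))
      · have h1 := apply_pow_of_commute (D := adjoint T) (T := C) (a := 1)
          (fun x => by rw [one_smul, h.A'C]) k ((B ^ l) n)
        rw [h1]
        refine Submodule.smul_mem _ _ ?_
        match l with
        | 0 => exact mem k 0 (hA' n hn)
        | 1 =>
          rw [pow_one, h.A'B, hB n hn, map_zero, smul_zero, sub_zero, map_smul]
          exact Submodule.smul_mem _ _ (by simpa using mem k 1 (hA' n hn))
        | l + 2 =>
          obtain ⟨a, ha⟩ := h.adjoint_A_B_pow (hC n hn) (hB n hn) l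
          rw [ha, map_add, map_smul, map_smul, ← pow_succ_apply']
          exact add_mem (Submodule.smul_mem _ _ (mem _ _ (hA' n hn)))
            (Submodule.smul_mem _ _ (mem _ _ hn))
    · constructor
      · rw [apply_pow_of_commute h.BC, ← pow_succ_apply]
        exact Submodule.smul_mem _ _ (mem _ _ hn)
      · rw [apply_pow_of_commute h.B'C]
        refine Submodule.smul_mem _ _ ?_
        cases l with
        | zero => simp [hB n hn]
        | succ l =>
          rw [h.isOscillatorOn_B.adjoint_pow_succ (hC n hn) (hB n hn), map_smul]
          exact Submodule.smul_mem _ _ (mem _ _ hn)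
    · constructor
      · rw [← pow_succ_apply]
        exact mem _ _ hn
      · cases k with
        | zero =>
          change adjoint _ ((B ^ l) n) ∈ _
          rw [hCB l hn]
          exact zero_mem _
        | succ k =>
          rw [h.isOscillatorOn_C.adjoint_pow_succ trivial (hCB l hn)]
          exact Submodule.smul_mem _ _ (mem _ _ hn)

lemma span_C_pow_dense (h : PointwiseRel q A B C) (hirr : IsIrreducibleFamily {A, B, C})
    {N : Submodule ℂ K} (hC : ∀ n ∈ N, adjoint C n = 0) (hA : ∀ n ∈ N, A n = 0)
    (hA' : ∀ n ∈ N, adjoint A n = -(q : ℂ)⁻¹ • C (adjoint B (adjoint B n)))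
    (hB : ∀ n ∈ N, B n ∈ N) (hB' : ∀ n ∈ N, adjoint B n ∈ N) (hN : N ≠ ⊥) :
    (Submodule.span ℂ {x | ∃ k : ℕ, ∃ n ∈ N, x = (C ^ k) n}).topologicalClosure = ⊤ := by
  set G : Set K := {x | ∃ k : ℕ, ∃ n ∈ N, x = (C ^ k) n} with hG
  have mem (k : ℕ) {n : K} (hn : n ∈ N) : (C ^ k) n ∈ Submodule.span ℂ G :=
    Submodule.subset_span ⟨k, n, hn, rfl⟩
  refine hirr.span_dense ?_ ?_
  · obtain ⟨n, hn, hn0⟩ := N.exists_mem_ne_zero_of_ne_bot hN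
    exact ⟨n, ⟨0, n, hn, rfl⟩, hn0⟩
  · rintro T (rfl | rfl | rfl) _ ⟨k, n, hn, rfl⟩
    · constructor
      · rw [h.A_C_pow, hA n hn, map_zero, zero_sub]
        exact neg_mem (Submodule.smul_mem _ _ (mem _ (hB _ (hB n hn))))
      · have h1 := apply_pow_of_commute (D := adjoint T) (T := C) (a := 1)
          (fun x => by rw [one_smul, h.A'C]) k n
        rw [h1, hA' n hn, map_smul, ← pow_succ_apply']
        exact Submodule.smul_mem _ _ (Submodule.smul_mem _ _ (mem _ (hB' _ (hB' n hn))))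
    · constructor
      · rw [apply_pow_of_commute h.BC]
        exact Submodule.smul_mem _ _ (mem _ (hB n hn))
      · rw [apply_pow_of_commute h.B'C]
        exact Submodule.smul_mem _ _ (mem _ (hB' n hn))
    · constructor
      · rw [← pow_succ_apply]
        exact mem _ hn
      · cases k with
        | zero => simp [hC n hn]
        | succ k =>
          rw [h.isOscillatorOn_C.adjoint_pow_succ trivial (hC n hn)]
          exact Submodule.smul_mem _ _ (mem _ hn)

end PointwiseRel

end Density

section Models

variable {K : Type} [NormedAddCommGroup K] [InnerProductSpace ℂ K]

/-- The family of all levels of a `c`-oscillator `T` above the vectors `u i`. -/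
def oscFamily {ι : Type} (c : ℝ) (T : K →L[ℂ] K) (u : ι → K) : ℕ × ι → K :=
  fun p => osc c T p.1 (u p.2)

lemma pow_mem_span_oscFamily {ι : Type} {c : ℝ} (hc : c ∈ Set.Ioo (0 : ℝ) 1) (T : K →L[ℂ] K)
    {u : ι → K} {x : K} (hx : x ∈ Submodule.span ℂ (Set.range u)) (k : ℕ) :
    (T ^ k) x ∈ Submodule.span ℂ (Set.range (oscFamily c T u)) := by
  obtain ⟨a, ha⟩ := pow_eq_smul_osc hc T k
  induction hx using Submodule.span_induction with
  | mem x hx =>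
    obtain ⟨i, rfl⟩ := hx
    rw [ha]
    exact Submodule.smul_mem _ _ (Submodule.subset_span ⟨(k, i), rfl⟩)
  | zero => simp
  | add x y _ _ hx hy => rw [map_add]; exact add_mem hx hy
  | smul b x _ hx => rw [map_smul]; exact Submodule.smul_mem _ _ hx

variable [CompleteSpace K]

lemma IsOscillatorOn.orthonormal_oscFamily {ι : Type} {c : ℝ} (hc : c ∈ Set.Ioo (0 : ℝ) 1)
    {T : K →L[ℂ] K} {W : Set K} (h : IsOscillatorOn c T W) {u : ι → K} (hu : Orthonormal ℂ u)
    (huW : ∀ i, u i ∈ W) (hu0 : ∀ i, adjoint T (u i) = 0) : Orthonormal ℂ (oscFamily c T u) := by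
  classical
  rw [orthonormal_iff_ite] at hu ⊢
  rintro ⟨k, i⟩ ⟨l, j⟩
  simp only [oscFamily, h.inner_osc hc (hu0 i) (huW j) (hu0 j), hu, Prod.mk.injEq]
  split_ifs <;> simp_all

omit [CompleteSpace K] in
lemma orthonormal_const {v : K} (hv : ‖v‖ = 1) : Orthonormal ℂ (fun _ : Unit => v) :=
  ⟨fun _ => hv, fun i j hij => (hij (Subsingleton.elim i j)).elim⟩

omit [CompleteSpace K] in
lemma span_topologicalClosure_eq_top_of_subset {G G' : Set K}
    (hG : (Submodule.span ℂ G).topologicalClosure = ⊤) (h : G ⊆ Submodule.span ℂ G') :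
    (Submodule.span ℂ G').topologicalClosure = ⊤ :=
  top_le_iff.1 (hG.ge.trans (Submodule.topologicalClosure_mono (Submodule.span_le.2 h)))

lemma aexp_add (θ φ : Real.Angle) : aexp (θ + φ) = aexp θ * aexp φ := by
  simp [aexp, Real.Angle.toCircle_add]

lemma aexp_ne_zero (θ : Real.Angle) : aexp θ ≠ 0 := Circle.coe_ne_zero _

lemma pow_mem_Ioo {q : ℝ} (hq : q ∈ Set.Ioo (0 : ℝ) 1) {n : ℕ} (hn : n ≠ 0) :
    q ^ n ∈ Set.Ioo (0 : ℝ) 1 := ⟨pow_pos hq.1 n, pow_lt_one₀ hq.1.le hq.2 hn⟩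

namespace PointwiseRel

variable {q : ℝ} {A B C : K →L[ℂ] K}

omit [CompleteSpace K] in
lemma C_osc (hq : q ∈ Set.Ioo (0 : ℝ) 1) (k : ℕ) (x : K) :
    C (osc (q ^ 4) C k x) = ((Real.sqrt (1 - q ^ (4 * k + 4)) : ℝ) : ℂ) •
      osc (q ^ 4) C (k + 1) x := by
  rw [apply_osc (pow_mem_Ioo hq four_ne_zero), ← pow_mul, mul_add, mul_one]

omit [CompleteSpace K] in
lemma B_osc (hq : q ∈ Set.Ioo (0 : ℝ) 1) (k : ℕ) (x : K) :
    B (osc (q ^ 2) B k x) = ((Real.sqrt (1 - q ^ (2 * k + 2)) : ℝ) : ℂ) •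
      osc (q ^ 2) B (k + 1) x := by
  rw [apply_osc (pow_mem_Ioo hq two_ne_zero), ← pow_mul, mul_add, mul_one]

lemma B_osc_C_osc_B (hq : q ∈ Set.Ioo (0 : ℝ) 1) (h : PointwiseRel q A B C) (k l : ℕ) (x : K) :
    B (osc (q ^ 4) C l (osc (q ^ 2) B k x)) =
      ((q ^ (2 * l) * Real.sqrt (1 - q ^ (2 * k + 2)) : ℝ) : ℂ) •
        osc (q ^ 4) C l (osc (q ^ 2) B (k + 1) x) := by
  rw [apply_osc_of_commute h.BC, B_osc hq, map_smul, smul_smul, ← pow_mul]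
  push_cast
  rfl

lemma A_osc_C_osc_B (hq : q ∈ Set.Ioo (0 : ℝ) 1) (h : PointwiseRel q A B C) (k l : ℕ) (x : K) :
    A (osc (q ^ 4) C l (osc (q ^ 2) B k x)) =
      ((q ^ (2 * k) : ℝ) : ℂ) • osc (q ^ 4) C l (osc (q ^ 2) B k (A x))
      - ((q⁻¹ * Real.sqrt ((1 - q ^ (4 * l)) * (1 - q ^ (2 * k + 2)) * (1 - q ^ (2 * k + 4)))
          : ℝ) : ℂ) • osc (q ^ 4) C (l - 1) (osc (q ^ 2) B (k + 2) x) := by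
  have h1 : 0 ≤ 1 - q ^ (4 * l) := sub_nonneg.2 (pow_le_one₀ hq.1.le hq.2.le)
  have h2 : 0 ≤ 1 - q ^ (2 * k + 2) := sub_nonneg.2 (pow_le_one₀ hq.1.le hq.2.le)
  rw [h.A_osc_C hq, apply_osc_of_commute h.AB, B_osc hq, B.map_smul, B_osc hq,
    Real.sqrt_mul (mul_nonneg h1 h2), Real.sqrt_mul h1]
  simp only [map_smul, smul_smul, ← pow_mul, show 2 * (k + 1) + 2 = 2 * k + 4 by ring]
  push_cast
  simp only [mul_assoc]

lemma unitarilyEquiv_three (hq : q ∈ Set.Ioo (0 : ℝ) 1) (h : PointwiseRel q A B C)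
    {φ : Real.Angle} {v : K} (hv : ‖v‖ = 1) (hC : adjoint C v = 0) (hA : A v = 0)
    (hB : B v = aexp φ • v)
    (hd : (Submodule.span ℂ {x | ∃ k : ℕ, ∃ n ∈ Submodule.span ℂ {v},
      x = (C ^ k) n}).topologicalClosure = ⊤) :
    UnitarilyEquivToModel q A B C (Sum.inr (Sum.inr (Sum.inl φ))) := by
  have hq4 := pow_mem_Ioo hq four_ne_zero
  set y := oscFamily (q ^ 4) C (fun _ : Unit => v) with hy
  have hyo : Orthonormal ℂ y := h.isOscillatorOn_C.orthonormal_oscFamily hq4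
    (orthonormal_const hv) (fun _ => trivial) (fun _ => hC)
  have hyd : (Submodule.span ℂ (Set.range y)).topologicalClosure = ⊤ := by
    refine span_topologicalClosure_eq_top_of_subset hd ?_
    rintro _ ⟨k, n, hn, rfl⟩
    exact pow_mem_span_oscFamily hq4 C (by simpa using hn) k
  set f : ℕ ≃ ℕ × Unit := (Equiv.prodPUnit ℕ).symm with hf
  obtain ⟨U, hU⟩ := exists_unitary_of_orthonormal (hyo.comp f f.injective)
    (by rwa [f.surjective.range_comp])
  have hU' (k : ℕ) : e k = U (osc (q ^ 4) C k v) := (hU k).symm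
  refine ⟨transport U A, transport U B, transport U C, fun k => ?_, fun k => ?_, fun k => ?_, U,
    intertwines_transport U A, intertwines_transport U B, intertwines_transport U C⟩
  · rw [hU', hU', transport_apply, ← map_smul, h.A_osc_C hq, hA, hB, map_smul, hB, aexp_add]
    congr 1
    simp only [map_smul, smul_smul, map_zero, zero_sub, ← neg_smul]
    push_cast
    congr 1
    ring
  · rw [hU', transport_apply, apply_osc_of_commute h.BC, hB]
    simp only [map_smul, smul_smul, ← pow_mul]
    push_cast
    rfl
  · rw [hU', hU', transport_apply, ← map_smul, C_osc hq]

lemma unitarilyEquiv_four (hq : q ∈ Set.Ioo (0 : ℝ) 1) (h : PointwiseRel q A B C)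
    {φ : Real.Angle} {v : K} (hv : ‖v‖ = 1) (hC : adjoint C v = 0) (hB : adjoint B v = 0)
    (hA : A v = aexp φ • v)
    (hd : (Submodule.span ℂ {x | ∃ k l : ℕ, ∃ n ∈ Submodule.span ℂ {v},
      x = (C ^ k) ((B ^ l) n)}).topologicalClosure = ⊤) :
    UnitarilyEquivToModel q A B C (Sum.inr (Sum.inr (Sum.inr (Sum.inl φ)))) := by
  have hq4 := pow_mem_Ioo hq four_ne_zero
  have hq2 := pow_mem_Ioo hq two_ne_zero
  set u := oscFamily (q ^ 2) B (fun _ : Unit => v) with hu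
  have huo : Orthonormal ℂ u := h.isOscillatorOn_B.orthonormal_oscFamily hq2
    (orthonormal_const hv) (fun _ => hC) (fun _ => hB)
  set y := oscFamily (q ^ 4) C u with hy
  have hyo : Orthonormal ℂ y := h.isOscillatorOn_C.orthonormal_oscFamily hq4
    huo (fun _ => trivial) (fun i => by
      rw [hu, oscFamily, apply_osc_of_commute h.C'B, hC, map_zero, smul_zero])
  have hyd : (Submodule.span ℂ (Set.range y)).topologicalClosure = ⊤ := by
    refine span_topologicalClosure_eq_top_of_subset hd ?_
    rintro _ ⟨k, l, n, hn, rfl⟩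
    exact pow_mem_span_oscFamily hq4 C (pow_mem_span_oscFamily hq2 B (by simpa using hn) l) k
  set f : ℕ × ℕ ≃ ℕ × ℕ × Unit :=
    (Equiv.prodComm ℕ ℕ).trans (Equiv.prodCongr (Equiv.refl ℕ) (Equiv.prodPUnit ℕ).symm) with hf
  obtain ⟨U, hU⟩ := exists_unitary_of_orthonormal (hyo.comp f f.injective)
    (by rwa [f.surjective.range_comp])
  have hU' (k l : ℕ) : e (k, l) = U (osc (q ^ 4) C l (osc (q ^ 2) B k v)) := (hU (k, l)).symm
  refine ⟨transport U A, transport U B, transport U C, fun k l => ?_, fun k l => ?_,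
    fun k l => ?_, U, intertwines_transport U A, intertwines_transport U B,
    intertwines_transport U C⟩
  · rw [hU', hU', transport_apply, ← U.map_smul, ← U.map_smul, ← U.map_sub, h.A_osc_C_osc_B hq, hA]
    simp only [map_smul, smul_smul]
  · rw [hU', hU', transport_apply, ← map_smul, h.B_osc_C_osc_B hq]
  · rw [hU', hU', transport_apply, ← map_smul, C_osc hq]

lemma unitarilyEquiv_five (hq : q ∈ Set.Ioo (0 : ℝ) 1) (h : PointwiseRel q A B C)
    {v : K} (hv : ‖v‖ = 1) (hC : adjoint C v = 0) (hB : adjoint B v = 0) (hA : adjoint A v = 0)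
    (hd : (Submodule.span ℂ {x | ∃ k l : ℕ, ∃ n ∈ Submodule.span ℂ {x | ∃ m : ℕ, x = (A ^ m) v},
      x = (C ^ k) ((B ^ l) n)}).topologicalClosure = ⊤) :
    UnitarilyEquivToModel q A B C (Sum.inr (Sum.inr (Sum.inr (Sum.inr ())))) := by
  have hq4 := pow_mem_Ioo hq four_ne_zero
  have hq2 := pow_mem_Ioo hq two_ne_zero
  set w := oscFamily (q ^ 4) A (fun _ : Unit => v) with hw
  have hwo : Orthonormal ℂ w := h.isOscillatorOn_A.orthonormal_oscFamily hq4
    (orthonormal_const hv) (fun _ => ⟨hC, hB⟩) (fun _ => hA)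
  have hwm (i : ℕ × Unit) : adjoint C (w i) = 0 ∧ adjoint B (w i) = 0 := by
    simp only [hw, oscFamily, osc, smul_apply, map_smul]
    have := pow_apply_mem h.isOscillatorOn_A.mem ⟨hC, hB⟩ i.1
    exact ⟨by rw [this.1, smul_zero], by rw [this.2, smul_zero]⟩
  set u := oscFamily (q ^ 2) B w with hu
  have huo : Orthonormal ℂ u := h.isOscillatorOn_B.orthonormal_oscFamily hq2
    hwo (fun i => (hwm i).1) (fun i => (hwm i).2)
  set y := oscFamily (q ^ 4) C u with hy
  have hyo : Orthonormal ℂ y := h.isOscillatorOn_C.orthonormal_oscFamily hq4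
    huo (fun _ => trivial) (fun i => by
      rw [hu, oscFamily, apply_osc_of_commute h.C'B, (hwm _).1, map_zero, smul_zero])
  have hN : Submodule.span ℂ {x | ∃ m : ℕ, x = (A ^ m) v} ≤ Submodule.span ℂ (Set.range w) := by
    rw [Submodule.span_le]
    rintro _ ⟨m, rfl⟩
    exact pow_mem_span_oscFamily hq4 A (Submodule.subset_span ⟨(), rfl⟩) m
  have hyd : (Submodule.span ℂ (Set.range y)).topologicalClosure = ⊤ := by
    refine span_topologicalClosure_eq_top_of_subset hd ?_
    rintro _ ⟨k, l, n, hn, rfl⟩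
    exact pow_mem_span_oscFamily hq4 C (pow_mem_span_oscFamily hq2 B (hN hn) l) k
  set f : ℕ × ℕ × ℕ ≃ ℕ × ℕ × ℕ × Unit := Equiv.prodCongr (Equiv.refl ℕ)
    (Equiv.prodCongr (Equiv.refl ℕ) (Equiv.prodPUnit ℕ).symm) with hf
  obtain ⟨U, hU⟩ := exists_unitary_of_orthonormal (hyo.comp f f.injective)
    (by rwa [f.surjective.range_comp])
  have hU' (k l m : ℕ) : e (k, l, m) =
    U (osc (q ^ 4) C k (osc (q ^ 2) B l (osc (q ^ 4) A m v))) := (hU (k, l, m)).symm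
  refine ⟨transport U A, transport U B, transport U C, fun k l m => ?_, fun k l m => ?_,
    fun k l m => ?_, U, intertwines_transport U A, intertwines_transport U B,
    intertwines_transport U C⟩
  · rw [hU', hU', hU', transport_apply, ← U.map_smul, ← U.map_smul, ← U.map_sub, h.A_osc_C_osc_B hq,
      C_osc (C := A) hq]
    simp only [map_smul, smul_smul]
    push_cast
    rfl
  · rw [hU', hU', transport_apply, ← map_smul, h.B_osc_C_osc_B hq]
  · rw [hU', hU', transport_apply, ← map_smul, C_osc hq]

end PointwiseRel

end Models

section Existence

variable {K : Type} [NormedAddCommGroup K] [InnerProductSpace ℂ K] [CompleteSpace K]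

lemma exists_aexp_of_isometry_eq_smul_one [Nontrivial K] {S : K →L[ℂ] K} {z : ℂ}
    (h : ∀ x, adjoint S (S x) = x) (hS : S = z • 1) : ∃ θ : Real.Angle, aexp θ = z := by
  obtain ⟨v, hv⟩ := exists_norm_eq K zero_le_one
  have h3 : inner ℂ (S v) (S v) = inner ℂ v v := by rw [← adjoint_inner_right, h]
  rw [inner_self_eq_ofReal, inner_self_eq_ofReal, hS, smul_apply, norm_smul, hv,
    one_apply_eq_self, hv] at h3
  have h4 := Complex.ofReal_injective h3
  have := norm_nonneg z
  exact exists_aexp_eq (by nlinarith)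

omit [CompleteSpace K] in
lemma nonempty_linearIsometryEquiv_of_forall_eq_smul_one [Nontrivial K]
    (h : ∀ S : K →L[ℂ] K, ∃ c : ℂ, S = c • (1 : K →L[ℂ] K)) : Nonempty (K ≃ₗᵢ[ℂ] ℂ) := by
  obtain ⟨v, hv⟩ := exists_norm_eq K zero_le_one
  obtain ⟨c, hc⟩ := h (InnerProductSpace.rankOne ℂ v v)
  have hcx (x : K) : inner ℂ v x • v = c • x := by
    have := congrArg (fun S : K →L[ℂ] K => S x) hc
    simpa using this
  have hc1 : c = 1 := by
    have := hcx v
    rw [inner_self_eq_ofReal, hv] at this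
    have hv0 : v ≠ 0 := by rintro rfl; simp at hv
    have h2 : (1 - c) • v = 0 := by rw [sub_smul, ← this]; simp
    exact (sub_eq_zero.1 ((smul_eq_zero.1 h2).resolve_right hv0)).symm
  exact ⟨(LinearIsometryEquiv.ofSurjective (LinearIsometry.toSpanSingleton ℂ K hv)
    fun x => ⟨inner ℂ v x, by simp [hcx, hc1]⟩).symm⟩

omit [CompleteSpace K] in
lemma exists_norm_one_smul {v : K} (hv : v ≠ 0) : ∃ a : ℂ, a ≠ 0 ∧ ‖a • v‖ = 1 :=
  ⟨((‖v‖⁻¹ : ℝ) : ℂ), by simpa using hv, by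
    rw [norm_smul, norm_real, norm_inv, norm_norm, inv_mul_cancel₀ (norm_ne_zero_iff.2 hv)]⟩

lemma adjoint_ofReal_smul (q : ℝ) (A : K →L[ℂ] K) :
    adjoint ((q : ℂ) • A) = (q : ℂ) • adjoint A := by
  rw [map_smulₛₗ, conj_ofReal]

namespace PointwiseRel

variable {q : ℝ} {A B C : K →L[ℂ] K}

lemma B_eq_zero (hq : q ∈ Set.Ioo (0 : ℝ) 1) (h : PointwiseRel q A B C)
    (hC : ∀ x, C (adjoint C x) = x) : B = 0 := by
  have h1 (x : K) : ‖B x‖ ≤ q * ‖adjoint B x‖ := by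
    have h1 : inner ℂ x (adjoint B (B x)) = ((‖B x‖ ^ 2 : ℝ) : ℂ) := by
      rw [adjoint_inner_right, inner_self_eq_ofReal]
    have h2 : inner ℂ x (B (adjoint B x)) = ((‖adjoint B x‖ ^ 2 : ℝ) : ℂ) := by
      rw [← adjoint_inner_left, inner_self_eq_ofReal]
    rw [h.B'B, hC, sub_add_cancel, inner_smul_right, h2] at h1
    have h3 : q ^ 2 * ‖adjoint B x‖ ^ 2 = ‖B x‖ ^ 2 := by exact_mod_cast h1
    refine le_of_sq_le_sq ?_ (by have := hq.1; positivity)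
    rw [← h3, mul_pow]
  have h2 : ‖B‖ ≤ q * ‖B‖ := by
    refine B.opNorm_le_bound (mul_nonneg hq.1.le (norm_nonneg _)) fun x => (h1 x).trans ?_
    rw [mul_assoc]
    have h3 := (adjoint B).le_opNorm x
    rw [LinearIsometryEquiv.norm_map] at h3
    exact mul_le_mul_of_nonneg_left h3 hq.1.le
  have h3 : ‖B‖ = 0 := by nlinarith [norm_nonneg B, hq.2]
  ext x
  have h4 := B.le_opNorm x
  rw [h3, zero_mul, norm_le_zero_iff] at h4
  exact h4

lemma unitarilyEquiv_two (hq : q ∈ Set.Ioo (0 : ℝ) 1) {φ : Real.Angle}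
    (hirr : IsIrreducibleFamily {A, B, C}) (hB : B = 0) (hC : C = aexp φ • 1)
    (hA : IsOscillatorOn (q ^ 4) ((q : ℂ) • A) Set.univ) {v : K} (hv : ‖v‖ = 1)
    (hv0 : adjoint ((q : ℂ) • A) v = 0) :
    UnitarilyEquivToModel q A B C (Sum.inr (Sum.inl φ)) := by
  have hq4 := pow_mem_Ioo hq four_ne_zero
  have hq0 : (q : ℂ) ≠ 0 := by exact_mod_cast hq.1.ne'
  set T := (q : ℂ) • A with hT
  have hAT (x : K) : A x = (q : ℂ)⁻¹ • T x := by
    rw [hT, smul_apply, inv_smul_smul₀ hq0]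
  have hAT' (x : K) : adjoint A x = (q : ℂ)⁻¹ • adjoint T x := by
    rw [hT, adjoint_ofReal_smul, smul_apply, inv_smul_smul₀ hq0]
  set y := oscFamily (q ^ 4) T (fun _ : Unit => v) with hy
  have hyo : Orthonormal ℂ y := hA.orthonormal_oscFamily hq4
    (orthonormal_const hv) (fun _ => trivial) (fun _ => hv0)
  have hyd : (Submodule.span ℂ (Set.range y)).topologicalClosure = ⊤ := by
    refine hirr.span_dense ⟨v, ⟨(0, ()), osc_zero _ _ _⟩, by rintro rfl; simp at hv⟩ ?_
    rintro S (rfl | rfl | rfl) _ ⟨⟨k, i⟩, rfl⟩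
    · rw [hAT, hAT']
      constructor
      · rw [hy, oscFamily, apply_osc hq4]
        exact Submodule.smul_mem _ _ (Submodule.smul_mem _ _
          (Submodule.subset_span ⟨(k + 1, ()), rfl⟩))
      · refine Submodule.smul_mem _ _ ?_
        cases k with
        | zero => simp [hy, oscFamily, osc_zero, hv0]
        | succ k =>
          rw [hy, oscFamily, hA.adjoint_osc_succ hq4 trivial hv0]
          exact Submodule.smul_mem _ _ (Submodule.subset_span ⟨(k, ()), rfl⟩)
    · simp [hB]
    · rw [hC]
      have := Submodule.subset_span (R := ℂ) (Set.mem_range_self (f := y) (k, i))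
      simp only [map_smulₛₗ, smul_apply, one_apply_eq_self]
      exact ⟨Submodule.smul_mem _ _ this, Submodule.smul_mem _ _ (by simpa [← star_eq_adjoint])⟩
  set f : ℕ ≃ ℕ × Unit := (Equiv.prodPUnit ℕ).symm with hf
  obtain ⟨U, hU⟩ := exists_unitary_of_orthonormal (hyo.comp f f.injective)
    (by rwa [f.surjective.range_comp])
  have hU' (k : ℕ) : e k = U (osc (q ^ 4) T k v) := (hU k).symm
  refine ⟨transport U A, fun k => ?_, U, intertwines_transport U A, fun x => by simp [hB],
    fun x => by simp [hC]⟩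
  rw [hU', hU', transport_apply, ← U.map_smul, hAT, C_osc hq, smul_smul]
  push_cast
  rfl

lemma exists_label_of_C_unitary [Nontrivial K] (hq : q ∈ Set.Ioo (0 : ℝ) 1)
    (h : PointwiseRel q A B C) (hirr : IsIrreducibleFamily {A, B, C})
    (hCC : ∀ x, C (adjoint C x) = x) : ∃ L, UnitarilyEquivToModel q A B C L := by
  have hq0 : (q : ℂ) ≠ 0 := by exact_mod_cast hq.1.ne'
  have hB := h.B_eq_zero hq hCC
  have hCC' (x : K) : adjoint C (C x) = x := by rw [h.C'C, hCC]; module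
  obtain ⟨z, hz⟩ := hirr C (by
    rintro T (rfl | rfl | rfl)
    · constructor <;> ext x
      · simpa [hB] using (h.AC x).symm
      · exact (h.A'C x).symm
    · simp [hB]
    · refine ⟨rfl, ?_⟩
      ext x
      simp [hCC, hCC'])
  obtain ⟨φ, rfl⟩ := exists_aexp_of_isometry_eq_smul_one hCC' hz
  have hA : IsOscillatorOn (q ^ 4) ((q : ℂ) • A) Set.univ := by
    refine ⟨fun _ _ => trivial, fun x _ => ?_⟩
    have h1 := h.A'A x
    rw [hCC, hB] at h1
    simp only [adjoint_ofReal_smul, smul_apply, map_smul, h1]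
    simp only [zero_apply, smul_zero, sub_zero]
    push_cast
    match_scalars <;> field_simp
    ring
  by_cases hAA : ∃ x, ((q : ℂ) • A) (adjoint ((q : ℂ) • A) x) ≠ x
  · obtain ⟨v, hv, hv0⟩ := exists_vacuum (pow_mem_Ioo hq four_ne_zero)
      (fun x => hA.rel x trivial) hAA
    obtain ⟨a, -, hav⟩ := exists_norm_one_smul hv
    exact ⟨_, unitarilyEquiv_two hq hirr hB hz hA hav (by rw [map_smul, hv0, smul_zero])⟩
  · push Not at hAA
    have hAA' (x : K) : adjoint ((q : ℂ) • A) (((q : ℂ) • A) x) = x := by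
      rw [hA.rel x trivial, hAA]
      push_cast
      module
    obtain ⟨w, hw⟩ := hirr ((q : ℂ) • A) (by
      rintro T (rfl | rfl | rfl)
      · refine ⟨by simp, ?_⟩
        ext x
        have h1 := (hAA x).trans (hAA' x).symm
        rw [adjoint_ofReal_smul] at h1
        simp only [smul_apply, map_smul] at h1
        rw [smul_mul_assoc, mul_smul_comm]
        exact smul_right_injective K hq0 h1
      · simp [hB]
      · simp only [hz, ← star_eq_adjoint, star_smul, star_one, mul_smul_comm, smul_mul_assoc,
          mul_one, one_mul]
        exact ⟨smul_comm _ _ _, smul_comm _ _ _⟩)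
    obtain ⟨ψ, rfl⟩ := exists_aexp_of_isometry_eq_smul_one hAA' hw
    have hA1 : A = ((q : ℂ)⁻¹ * aexp ψ) • 1 := by
      rw [← smul_smul, ← hw, inv_smul_smul₀ hq0]
    obtain ⟨U⟩ := nonempty_linearIsometryEquiv_of_forall_eq_smul_one fun S => hirr S (by
      rintro T (rfl | rfl | rfl)
      · simp [hA1, ← star_eq_adjoint]
      · simp [hB]
      · simp [hz, ← star_eq_adjoint])
    exact ⟨Sum.inl (ψ, φ), U, fun x => by simp [hA1], fun x => by simp [hB],
      fun x => by simp [hz]⟩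

lemma exists_label_three (hq : q ∈ Set.Ioo (0 : ℝ) 1)
    (h : PointwiseRel q A B C) (hirr : IsIrreducibleFamily {A, B, C})
    (hC0 : ∃ v, v ≠ 0 ∧ adjoint C v = 0)
    (hBB : ∀ x, adjoint C x = 0 → B (adjoint B x) = x) :
    ∃ φ, UnitarilyEquivToModel q A B C (Sum.inr (Sum.inr (Sum.inl φ))) := by
  have hq0 : (q : ℂ) ≠ 0 := by exact_mod_cast hq.1.ne'
  set V : Submodule ℂ K := LinearMap.ker (adjoint C).toLinearMap with hV
  have hVm {x : K} : x ∈ V ↔ adjoint C x = 0 := LinearMap.mem_ker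
  have hVc : IsClosed (V : Set K) := (adjoint C).isClosed_ker
  have hVB (x : K) (hx : x ∈ V) : B x ∈ V := h.isOscillatorOn_B.mem x hx
  have hVB' (x : K) (hx : x ∈ V) : adjoint B x ∈ V := h.adjoint_B_mem hx
  have hVBB (x : K) (hx : x ∈ V) : adjoint B (B x) = x := by
    rw [h.isOscillatorOn_B.rel x hx, hBB x hx]
    push_cast
    module
  have hVA : ∀ x ∈ V, A x = 0 := eq_zero_of_conj hq (h.norm_B_le hq) hVB' fun x hx => by
    rw [← h.AB, hBB x hx]
  have hVA' : ∀ x ∈ V, (adjoint A + (q : ℂ)⁻¹ • (C * (adjoint B * adjoint B))) x = 0 := by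
    refine eq_zero_of_conj hq (h.norm_B_le hq) hVB' fun x hx => ?_
    have hy := hVB' x hx
    obtain ⟨y, hyx⟩ : ∃ y, y = adjoint B x := ⟨_, rfl⟩
    rw [← hyx] at hy ⊢
    rw [← hBB x hx, ← hyx]
    simp only [add_apply, smul_apply, mul_apply_eq_comp, h.A'B, hVBB y hy, map_add, map_smul, h.BC,
      hBB _ (hVB' y hy)]
    match_scalars <;> field_simp
    ring
  have hdense {N : Submodule ℂ K} (hNV : N ≤ V) (hB : ∀ n ∈ N, B n ∈ N)
      (hB' : ∀ n ∈ N, adjoint B n ∈ N) (hN : N ≠ ⊥) :=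
    h.span_C_pow_dense hirr (fun n hn => hNV hn) (fun n hn => hVA n (hNV hn)) (fun n hn => by
      rw [neg_smul, ← add_eq_zero_iff_eq_neg]
      exact hVA' n (hNV hn)) hB hB' hN
  obtain ⟨φ, v, hvV, hv, hBv, hB'v⟩ := exists_unit_eigenvector hVc
    (by
      obtain ⟨v, hv, hv0⟩ := hC0
      exact V.ne_bot_iff.2 ⟨v, hv0, hv⟩)
    hVB hVB' hVBB hBB (fun N hNV hN hB hB' hN0 =>
      eq_of_le_of_forall_orthogonal hNV hN fun w hw hwN =>
        eq_zero_of_dense (hdense hNV hB hB' hN0) (by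
          rintro _ ⟨k, n, hn, rfl⟩
          cases k with
          | zero => exact hwN n hn
          | succ k => rw [pow_succ_apply, ← adjoint_inner_right, hVm.1 hw, inner_zero_right]))
  refine ⟨φ, h.unitarilyEquiv_three hq hv hvV (hVA v hvV) hBv (hdense ?_ ?_ ?_ ?_)⟩
  · simpa [Submodule.span_le] using hvV
  · intro n hn
    obtain ⟨a, rfl⟩ := Submodule.mem_span_singleton.1 hn
    rw [map_smul, hBv]
    exact Submodule.smul_mem _ _ (Submodule.smul_mem _ _ (Submodule.mem_span_singleton_self v))
  · intro n hn
    obtain ⟨a, rfl⟩ := Submodule.mem_span_singleton.1 hn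
    rw [map_smul, hB'v]
    exact Submodule.smul_mem _ _ (Submodule.smul_mem _ _ (Submodule.mem_span_singleton_self v))
  · rw [Ne, Submodule.span_singleton_eq_bot]
    rintro rfl
    simp at hv

lemma exists_label_four (hq : q ∈ Set.Ioo (0 : ℝ) 1)
    (h : PointwiseRel q A B C) (hirr : IsIrreducibleFamily {A, B, C}) {V : Submodule ℂ K}
    (hVm : ∀ {x : K}, x ∈ V ↔ adjoint C x = 0 ∧ adjoint B x = 0) (hV0 : V ≠ ⊥)
    (hVc : IsClosed (V : Set K)) (hAA : ∀ x ∈ V, A (adjoint A x) = x) :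
    ∃ φ, UnitarilyEquivToModel q A B C (Sum.inr (Sum.inr (Sum.inr (Sum.inl φ)))) := by
  have hVA (x : K) (hx : x ∈ V) : A x ∈ V := hVm.2 (h.isOscillatorOn_A.mem x (hVm.1 hx))
  have hVA' (x : K) (hx : x ∈ V) : adjoint A x ∈ V :=
    hVm.2 (h.adjoint_A_mem (hVm.1 hx).1 (hVm.1 hx).2)
  have hVAA (x : K) (hx : x ∈ V) : adjoint A (A x) = x := by
    rw [h.isOscillatorOn_A.rel x (hVm.1 hx), hAA x hx]
    push_cast
    module
  have hdense {N : Submodule ℂ K} (hNV : N ≤ V) (hA : ∀ n ∈ N, A n ∈ N)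
      (hA' : ∀ n ∈ N, adjoint A n ∈ N) (hN : N ≠ ⊥) :=
    h.span_C_pow_B_pow_dense hirr (fun n hn => (hVm.1 (hNV hn)).1)
      (fun n hn => (hVm.1 (hNV hn)).2) hA hA' hN
  obtain ⟨φ, v, hvV, hv, hAv, hA'v⟩ := exists_unit_eigenvector hVc hV0
    hVA hVA' hVAA hAA (fun N hNV hN hA hA' hN0 =>
      eq_of_le_of_forall_orthogonal hNV hN fun w hw hwN =>
        eq_zero_of_dense (hdense hNV hA hA' hN0) (by
          rintro _ ⟨k, l, n, hn, rfl⟩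
          match k, l with
          | 0, 0 => exact hwN n hn
          | 0, l + 1 =>
            rw [pow_zero, one_apply_eq_self, pow_succ_apply, ← adjoint_inner_right,
              (hVm.1 hw).2, inner_zero_right]
          | k + 1, l =>
            rw [pow_succ_apply, ← adjoint_inner_right, (hVm.1 hw).1, inner_zero_right]))
  obtain ⟨hvC, hvB⟩ := hVm.1 hvV
  refine ⟨φ, h.unitarilyEquiv_four hq hv hvC hvB hAv (hdense ?_ ?_ ?_ ?_)⟩
  · simpa [Submodule.span_le] using hvV
  · intro n hn
    obtain ⟨a, rfl⟩ := Submodule.mem_span_singleton.1 hn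
    rw [map_smul, hAv]
    exact Submodule.smul_mem _ _ (Submodule.smul_mem _ _ (Submodule.mem_span_singleton_self v))
  · intro n hn
    obtain ⟨a, rfl⟩ := Submodule.mem_span_singleton.1 hn
    rw [map_smul, hA'v]
    exact Submodule.smul_mem _ _ (Submodule.smul_mem _ _ (Submodule.mem_span_singleton_self v))
  · rw [Ne, Submodule.span_singleton_eq_bot]
    rintro rfl
    simp at hv

lemma unitarilyEquiv_five_of_vacuum (hq : q ∈ Set.Ioo (0 : ℝ) 1) (h : PointwiseRel q A B C)
    (hirr : IsIrreducibleFamily {A, B, C}) {v : K} (hv : ‖v‖ = 1) (hC : adjoint C v = 0)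
    (hB : adjoint B v = 0) (hA : adjoint A v = 0) :
    UnitarilyEquivToModel q A B C (Sum.inr (Sum.inr (Sum.inr (Sum.inr ())))) := by
  refine h.unitarilyEquiv_five hq hv hC hB hA (h.span_C_pow_B_pow_dense hirr ?_ ?_ ?_ ?_ ?_)
  · intro n hn
    have : Submodule.span ℂ {x | ∃ m : ℕ, x = (A ^ m) v} ≤
        LinearMap.ker (adjoint C).toLinearMap := by
      rw [Submodule.span_le]
      rintro _ ⟨m, rfl⟩
      exact (pow_apply_mem h.isOscillatorOn_A.mem ⟨hC, hB⟩ m).1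
    exact this hn
  · intro n hn
    have : Submodule.span ℂ {x | ∃ m : ℕ, x = (A ^ m) v} ≤
        LinearMap.ker (adjoint B).toLinearMap := by
      rw [Submodule.span_le]
      rintro _ ⟨m, rfl⟩
      exact (pow_apply_mem h.isOscillatorOn_A.mem ⟨hC, hB⟩ m).2
    exact this hn
  · intro n hn
    have : Submodule.span ℂ {x | ∃ m : ℕ, x = (A ^ m) v} ≤
        (Submodule.span ℂ {x | ∃ m : ℕ, x = (A ^ m) v}).comap A.toLinearMap := by
      rw [Submodule.span_le]
      rintro _ ⟨m, rfl⟩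
      exact Submodule.subset_span ⟨m + 1, (pow_succ_apply A m v).symm⟩
    exact this hn
  · intro n hn
    have : Submodule.span ℂ {x | ∃ m : ℕ, x = (A ^ m) v} ≤
        (Submodule.span ℂ {x | ∃ m : ℕ, x = (A ^ m) v}).comap (adjoint A).toLinearMap := by
      rw [Submodule.span_le]
      rintro _ ⟨m, rfl⟩
      change adjoint A ((A ^ m) v) ∈ Submodule.span ℂ _
      cases m with
      | zero =>
        change adjoint A v ∈ Submodule.span ℂ _
        rw [hA]
        exact zero_mem _
      | succ m =>
        rw [h.isOscillatorOn_A.adjoint_pow_succ ⟨hC, hB⟩ hA]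
        exact Submodule.smul_mem _ _ (Submodule.subset_span ⟨m, rfl⟩)
    exact this hn
  · refine (Submodule.ne_bot_iff _).2 ⟨v, Submodule.subset_span ⟨0, rfl⟩, ?_⟩
    rintro rfl
    simp at hv

lemma exists_label [Nontrivial K] (hq : q ∈ Set.Ioo (0 : ℝ) 1) (h : PointwiseRel q A B C)
    (hirr : IsIrreducibleFamily {A, B, C}) : ∃ L, UnitarilyEquivToModel q A B C L := by
  have hq4 := pow_mem_Ioo hq four_ne_zero
  by_cases hCC : ∀ x, C (adjoint C x) = x
  · exact h.exists_label_of_C_unitary hq hirr hCC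
  push Not at hCC
  have hC0 := exists_vacuum hq4 (fun x => h.isOscillatorOn_C.rel x trivial) hCC
  by_cases hBB : ∀ x, adjoint C x = 0 → B (adjoint B x) = x
  · obtain ⟨φ, hφ⟩ := h.exists_label_three hq hirr hC0 hBB
    exact ⟨_, hφ⟩
  push Not at hBB
  obtain ⟨v, hvC, hv0, hvB⟩ := exists_vacuum_mem
    (W := LinearMap.ker (adjoint C).toLinearMap) (adjoint C).isClosed_ker
    (pow_mem_Ioo hq two_ne_zero) h.isOscillatorOn_B.mem (fun x hx => h.adjoint_B_mem hx)
    h.isOscillatorOn_B.rel hBB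
  set V : Submodule ℂ K :=
    LinearMap.ker (adjoint C).toLinearMap ⊓ LinearMap.ker (adjoint B).toLinearMap with hV
  have hVc : IsClosed (V : Set K) := (adjoint C).isClosed_ker.inter (adjoint B).isClosed_ker
  by_cases hAA : ∀ x ∈ V, A (adjoint A x) = x
  · obtain ⟨φ, hφ⟩ := h.exists_label_four hq hirr (V := V) Iff.rfl
      (V.ne_bot_iff.2 ⟨v, ⟨hvC, hvB⟩, hv0⟩) hVc hAA
    exact ⟨_, hφ⟩
  push Not at hAA
  obtain ⟨u, ⟨huC, huB⟩, hu0, huA⟩ := exists_vacuum_mem hVc hq4 h.isOscillatorOn_A.mem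
    (fun x hx => h.adjoint_A_mem hx.1 hx.2) h.isOscillatorOn_A.rel hAA
  obtain ⟨a, -, ha⟩ := exists_norm_one_smul hu0
  have huC' : adjoint C u = 0 := huC
  have huB' : adjoint B u = 0 := huB
  exact ⟨_, h.unitarilyEquiv_five_of_vacuum hq hirr ha (by rw [map_smul, huC', smul_zero])
    (by rw [map_smul, huB', smul_zero]) (by rw [map_smul, huA, smul_zero])⟩

end PointwiseRel

end Existence

section Uniqueness

variable {K : Type} [NormedAddCommGroup K] [InnerProductSpace ℂ K]

lemma aexp_injective : Function.Injective aexp := fun θ φ h => by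
  have h1 : θ.toCircle = φ.toCircle := Circle.ext h
  rw [← Real.Angle.arg_toCircle θ, h1, Real.Angle.arg_toCircle]

lemma exists_basis_of_unitary {ι : Type} [DecidableEq ι] (U : K ≃ₗᵢ[ℂ] L2 ι) :
    ∃ x : ι → K, (∀ i, U (x i) = e i) ∧ (∀ i, x i ≠ 0) ∧
      (∀ i j, i ≠ j → inner ℂ (x i) (x j) = 0) ∧
      (∀ w, (∀ i, inner ℂ (x i) w = 0) → w = 0) ∧
      ∀ w i, (∀ j, j ≠ i → inner ℂ (x j) w = 0) → ∃ a : ℂ, w = a • x i := by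
  have hin (i : ι) (w : K) : inner ℂ (U.symm (e i)) w = U w i := by
    rw [← U.inner_map_map, U.apply_symm_apply, e, lp.inner_single_left]
    simp
  refine ⟨fun i => U.symm (e i), fun i => U.apply_symm_apply _, fun i hi => ?_, fun i j hij => ?_,
    fun w hw => ?_, fun w i hw => ⟨U w i, ?_⟩⟩
  · have hi' : U.symm (e i) = 0 := hi
    have h1 := hin i (U.symm (e i))
    rw [U.apply_symm_apply, hi', inner_zero_left] at h1
    exact zero_ne_one (h1.trans (lp.single_apply_self 2 i 1))
  · rw [hin, U.apply_symm_apply, e, lp.single_apply_ne _ _ _ hij]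
  · rw [← map_eq_zero_iff U U.injective]
    ext i
    rw [← hin, hw]
    rfl
  · apply U.injective
    ext j
    rw [map_smul, U.apply_symm_apply]
    by_cases hj : j = i
    · subst hj
      simp [e]
    · rw [← hin, hw j hj]
      simp [e, hj]

lemma apply_eq_of_intertwines {ι : Type} [DecidableEq ι] {U : K ≃ₗᵢ[ℂ] L2 ι} {T : K →L[ℂ] K}
    {T' : L2 ι →L[ℂ] L2 ι} (h : Intertwines U T T') {x y : K} (hxy : T' (U x) = U y) : T x = y :=
  U.injective ((h x).trans hxy)

variable [CompleteSpace K]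

/-- The operators in `S` have a common nonzero vector annihilated by all their adjoints. -/
def HasVacuum (S : Set (K →L[ℂ] K)) : Prop := ∃ v, v ≠ 0 ∧ ∀ T ∈ S, adjoint T v = 0

lemma HasVacuum.mono {S S' : Set (K →L[ℂ] K)} (h : HasVacuum S') (hS : S ⊆ S') : HasVacuum S :=
  let ⟨v, hv, hv'⟩ := h
  ⟨v, hv, fun T hT => hv' T (hS hT)⟩

lemma eq_zero_of_apply_eq_smul {T : K →L[ℂ] K} {z : ℂ} (hz : z ≠ 0) {w : K} (h : T w = z • w)
    (h' : adjoint T w = 0) : w = 0 := by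
  have h1 : inner ℂ w (T w) = 0 := by rw [← adjoint_inner_left, h', inner_zero_left]
  rw [h, inner_smul_right] at h1
  exact inner_self_eq_zero.1 ((mul_eq_zero.1 h1).resolve_left hz)

lemma inner_eq_zero_of_adjoint {T : K →L[ℂ] K} {s : ℂ} (hs : s ≠ 0) {x y w : K}
    (h : T x = s • y) (hw : adjoint T w = 0) : inner ℂ y w = 0 := by
  have h1 : inner ℂ (T x) w = 0 := by rw [← adjoint_inner_right, hw, inner_zero_right]
  rw [h, inner_smul_left] at h1
  exact (mul_eq_zero.1 h1).resolve_left (by simpa using hs)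

lemma adjoint_eq_zero_of_forall_inner {ι : Type} {x : ι → K}
    (hx : ∀ w, (∀ i, inner ℂ (x i) w = 0) → w = 0) {T : K →L[ℂ] K} {v : K}
    (h : ∀ i, inner ℂ (T (x i)) v = 0) : adjoint T v = 0 :=
  hx _ fun i => by rw [adjoint_inner_right, h]

lemma ofReal_sqrt_one_sub_pow_ne_zero {q : ℝ} (hq : q ∈ Set.Ioo (0 : ℝ) 1) {n : ℕ} (hn : n ≠ 0) :
    ((Real.sqrt (1 - q ^ n) : ℝ) : ℂ) ≠ 0 := by
  exact_mod_cast (Real.sqrt_pos.2 (sub_pos.2 (pow_lt_one₀ hq.1.le hq.2 hn))).ne'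

namespace UnitarilyEquivToModel

variable {q : ℝ} {A B C : K →L[ℂ] K}

lemma one_apply {ψ φ : Real.Angle} (h : UnitarilyEquivToModel q A B C (Sum.inl (ψ, φ))) :
    (∀ x, C x = aexp φ • x) ∧ ∀ x, A x = ((q : ℂ)⁻¹ * aexp ψ) • x := by
  obtain ⟨U, hA, -, hC⟩ := h
  exact ⟨fun x => U.injective (by simpa using hC x), fun x => U.injective (by simpa using hA x)⟩

lemma two_apply {φ : Real.Angle} (h : UnitarilyEquivToModel q A B C (Sum.inr (Sum.inl φ))) :
    HasVacuum {A} ∧ ∀ x, C x = aexp φ • x := by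
  obtain ⟨Z, hZ, U, hA, -, hC⟩ := h
  refine ⟨?_, fun x => U.injective (by simpa using hC x)⟩
  obtain ⟨x, hx, hx0, hxo, hxd, -⟩ := exists_basis_of_unitary U
  have hAx (k : ℕ) : A (x k) = ((q⁻¹ * Real.sqrt (1 - q ^ (4 * k + 4)) : ℝ) : ℂ) • x (k + 1) :=
    apply_eq_of_intertwines hA (by rw [hx, hZ, U.map_smul, hx])
  refine ⟨x 0, hx0 0, ?_⟩
  rintro _ rfl
  refine adjoint_eq_zero_of_forall_inner hxd fun k => ?_
  rw [hAx, inner_smul_left,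
    hxo _ _ k.succ_ne_zero, mul_zero]

lemma three_apply (hq : q ∈ Set.Ioo (0 : ℝ) 1) {φ : Real.Angle}
    (h : UnitarilyEquivToModel q A B C (Sum.inr (Sum.inr (Sum.inl φ)))) :
    HasVacuum {C} ∧ ∀ w, adjoint C w = 0 → B w = aexp φ • w := by
  obtain ⟨-, Z₂, Z₃, -, h₂, h₃, U, -, hB, hC⟩ := h
  obtain ⟨x, hx, hx0, hxo, hxd, hxi⟩ := exists_basis_of_unitary U
  have hCx (k : ℕ) : C (x k) = ((Real.sqrt (1 - q ^ (4 * k + 4)) : ℝ) : ℂ) • x (k + 1) :=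
    apply_eq_of_intertwines hC (by rw [hx, h₃, U.map_smul, hx])
  have hBx (k : ℕ) : B (x k) = (((q ^ (2 * k) : ℝ) : ℂ) * aexp φ) • x k :=
    apply_eq_of_intertwines hB (by rw [hx, h₂, U.map_smul, hx])
  refine ⟨⟨x 0, hx0 0, ?_⟩, fun w hw => ?_⟩
  · rintro _ rfl
    refine adjoint_eq_zero_of_forall_inner hxd fun k => ?_
    rw [hCx, inner_smul_left, hxo _ _ k.succ_ne_zero, mul_zero]
  · obtain ⟨a, rfl⟩ := hxi w 0 fun j hj => by
      obtain ⟨k, rfl⟩ := Nat.exists_eq_succ_of_ne_zero hj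
      exact inner_eq_zero_of_adjoint (ofReal_sqrt_one_sub_pow_ne_zero hq (by omega)) (hCx k) hw
    rw [map_smul, hBx]
    simp [smul_comm a]

lemma four_apply (hq : q ∈ Set.Ioo (0 : ℝ) 1) {φ : Real.Angle}
    (h : UnitarilyEquivToModel q A B C (Sum.inr (Sum.inr (Sum.inr (Sum.inl φ))))) :
    HasVacuum {B, C} ∧ ∀ w, adjoint C w = 0 → adjoint B w = 0 → A w = aexp φ • w := by
  obtain ⟨Z₁, Z₂, Z₃, h₁, h₂, h₃, U, hA, hB, hC⟩ := h
  obtain ⟨x, hx, hx0, hxo, hxd, hxi⟩ := exists_basis_of_unitary U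
  have hCx (k l : ℕ) :
      C (x (k, l)) = ((Real.sqrt (1 - q ^ (4 * l + 4)) : ℝ) : ℂ) • x (k, l + 1) :=
    apply_eq_of_intertwines hC (by rw [hx, h₃, U.map_smul, hx])
  have hBx (k l : ℕ) : B (x (k, l)) =
      ((q ^ (2 * l) * Real.sqrt (1 - q ^ (2 * k + 2)) : ℝ) : ℂ) • x (k + 1, l) :=
    apply_eq_of_intertwines hB (by rw [hx, h₂, U.map_smul, hx])
  have hAx := apply_eq_of_intertwines hA (x := x (0, 0)) (y := aexp φ • x (0, 0))
    (by rw [hx, h₁, U.map_smul, hx]; simp)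
  refine ⟨⟨x (0, 0), hx0 _, ?_⟩, fun w hwC hwB => ?_⟩
  · rintro _ (rfl | rfl) <;> refine adjoint_eq_zero_of_forall_inner hxd fun ⟨k, l⟩ => ?_
    · rw [hBx, inner_smul_left, hxo _ _ (by simp), mul_zero]
    · rw [hCx, inner_smul_left, hxo _ _ (by simp), mul_zero]
  · obtain ⟨a, rfl⟩ := hxi w (0, 0) fun j hj => by
      match j with
      | (0, 0) => exact absurd rfl hj
      | (k, l + 1) =>
        exact inner_eq_zero_of_adjoint (ofReal_sqrt_one_sub_pow_ne_zero hq (by omega))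
          (hCx k l) hwC
      | (k + 1, 0) =>
        refine inner_eq_zero_of_adjoint ?_ (hBx k 0) hwB
        rw [ofReal_mul]
        exact mul_ne_zero (by simp) (ofReal_sqrt_one_sub_pow_ne_zero hq (by omega))
    rw [map_smul, hAx, smul_comm]

lemma five_hasVacuum
    (h : UnitarilyEquivToModel q A B C (Sum.inr (Sum.inr (Sum.inr (Sum.inr ()))))) :
    HasVacuum {A, B, C} := by
  obtain ⟨Z₁, Z₂, Z₃, h₁, h₂, h₃, U, hA, hB, hC⟩ := h
  obtain ⟨x, hx, hx0, hxo, hxd, -⟩ := exists_basis_of_unitary U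
  have hCx (k l m : ℕ) :
      C (x (k, l, m)) = ((Real.sqrt (1 - q ^ (4 * k + 4)) : ℝ) : ℂ) • x (k + 1, l, m) :=
    apply_eq_of_intertwines hC (by rw [hx, h₃, U.map_smul, hx])
  have hBx (k l m : ℕ) : B (x (k, l, m)) =
      ((q ^ (2 * k) * Real.sqrt (1 - q ^ (2 * l + 2)) : ℝ) : ℂ) • x (k, l + 1, m) :=
    apply_eq_of_intertwines hB (by rw [hx, h₂, U.map_smul, hx])
  have hAx (k l m : ℕ) : A (x (k, l, m)) =
      ((q ^ (2 * l) * Real.sqrt (1 - q ^ (4 * m + 4)) : ℝ) : ℂ) • x (k, l, m + 1) -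
        ((q⁻¹ * Real.sqrt ((1 - q ^ (4 * k)) * (1 - q ^ (2 * l + 2)) * (1 - q ^ (2 * l + 4)))
          : ℝ) : ℂ) • x (k - 1, l + 2, m) :=
    apply_eq_of_intertwines hA
      (by rw [hx, h₁, U.map_sub, U.map_smul, U.map_smul, hx, hx])
  refine ⟨x (0, 0, 0), hx0 _, ?_⟩
  rintro _ (rfl | rfl | rfl) <;>
    refine adjoint_eq_zero_of_forall_inner hxd fun ⟨k, l, m⟩ => ?_
  · rw [hAx, inner_sub_left, inner_smul_left, inner_smul_left, hxo _ _ (by simp),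
      hxo _ _ (by simp), mul_zero, mul_zero, sub_zero]
  · rw [hBx, inner_smul_left, hxo _ _ (by simp), mul_zero]
  · rw [hCx, inner_smul_left, hxo _ _ (by simp), mul_zero]

lemma not_hasVacuum_of_forall {S : Set (K →L[ℂ] K)} {T : K →L[ℂ] K} (hT : T ∈ S) {z : ℂ}
    (hz : z ≠ 0) (h : ∀ w, (∀ T ∈ S, adjoint T w = 0) → T w = z • w) : ¬ HasVacuum S :=
  fun ⟨v, hv, hv'⟩ => hv (eq_zero_of_apply_eq_smul hz (h v hv') (hv' T hT))

/-- The joint vacua of the adjoints, together with the operators' action on them, that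
determine the label of a representation. -/
def Signature (q : ℝ) (A B C : K →L[ℂ] K) : RepLabel → Prop
  | Sum.inl (ψ, φ) => ¬ HasVacuum {C} ∧ ¬ HasVacuum {A} ∧ (∀ x, C x = aexp φ • x) ∧
      ∀ x, A x = ((q : ℂ)⁻¹ * aexp ψ) • x
  | Sum.inr (Sum.inl φ) => ¬ HasVacuum {C} ∧ HasVacuum {A} ∧ ∀ x, C x = aexp φ • x
  | Sum.inr (Sum.inr (Sum.inl φ)) => HasVacuum {C} ∧ ¬ HasVacuum {B, C} ∧
      ∀ w, adjoint C w = 0 → B w = aexp φ • w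
  | Sum.inr (Sum.inr (Sum.inr (Sum.inl φ))) => HasVacuum {B, C} ∧ ¬ HasVacuum {A, B, C} ∧
      ∀ w, adjoint C w = 0 → adjoint B w = 0 → A w = aexp φ • w
  | Sum.inr (Sum.inr (Sum.inr (Sum.inr _))) => HasVacuum {A, B, C}

lemma signature (hq : q ∈ Set.Ioo (0 : ℝ) 1) :
    ∀ {L : RepLabel}, UnitarilyEquivToModel q A B C L → Signature q A B C L := by
  have hq0 : (q : ℂ)⁻¹ ≠ 0 := inv_ne_zero (by exact_mod_cast hq.1.ne')
  have not_C {φ : Real.Angle} (h : ∀ x, C x = aexp φ • x) : ¬ HasVacuum {C} :=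
    not_hasVacuum_of_forall rfl (aexp_ne_zero φ) fun w _ => h w
  rintro (⟨ψ, φ⟩ | φ | φ | φ | _) h
  · exact ⟨not_C h.one_apply.1, not_hasVacuum_of_forall rfl (mul_ne_zero hq0 (aexp_ne_zero ψ))
      fun w _ => h.one_apply.2 w, h.one_apply⟩
  · exact ⟨not_C h.two_apply.2, h.two_apply⟩
  · refine ⟨(h.three_apply hq).1, ?_, (h.three_apply hq).2⟩
    exact not_hasVacuum_of_forall (T := B) (by simp) (aexp_ne_zero φ) fun w hw =>
      (h.three_apply hq).2 w (hw C (by simp))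
  · refine ⟨(h.four_apply hq).1, ?_, (h.four_apply hq).2⟩
    exact not_hasVacuum_of_forall (T := A) (by simp) (aexp_ne_zero φ) fun w hw =>
      (h.four_apply hq).2 w (hw C (by simp)) (hw B (by simp))
  · exact h.five_hasVacuum

lemma label_unique [Nontrivial K] (hq : q ∈ Set.Ioo (0 : ℝ) 1) {L L' : RepLabel}
    (h : UnitarilyEquivToModel q A B C L) (h' : UnitarilyEquivToModel q A B C L') : L = L' := by
  obtain ⟨v, hv⟩ := exists_ne (0 : K)
  have hq0 : (q : ℂ)⁻¹ ≠ 0 := inv_ne_zero (by exact_mod_cast hq.1.ne')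
  have cancel {θ φ : Real.Angle} {T : K →L[ℂ] K} {w : K} (hw : w ≠ 0) (h : T w = aexp θ • w)
      (h' : T w = aexp φ • w) : θ = φ :=
    aexp_injective (smul_left_injective ℂ hw (h.symm.trans h'))
  have vac_BC : HasVacuum {A, B, C} → HasVacuum {B, C} := fun h => h.mono (by simp)
  have vac_C : HasVacuum {B, C} → HasVacuum {C} := fun h => h.mono (by simp)
  replace h := signature hq h
  replace h' := signature hq h'
  rcases L with ⟨ψ, φ⟩ | φ | φ | φ | _ <;> rcases L' with ⟨ψ', φ'⟩ | φ' | φ' | φ' | _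
  · obtain ⟨-, -, hC, hA⟩ := h
    obtain ⟨-, -, hC', hA'⟩ := h'
    have hψ := smul_left_injective ℂ hv ((hA v).symm.trans (hA' v))
    rw [cancel hv (hC v) (hC' v), aexp_injective (mul_left_cancel₀ hq0 hψ)]
  · exact absurd h'.2.1 h.2.1
  · exact absurd h'.1 h.1
  · exact absurd (vac_C h'.1) h.1
  · exact absurd (vac_C (vac_BC h')) h.1
  · exact absurd h.2.1 h'.2.1
  · rw [cancel hv (h.2.2 v) (h'.2.2 v)]
  · exact absurd h'.1 h.1
  · exact absurd (vac_C h'.1) h.1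
  · exact absurd (vac_C (vac_BC h')) h.1
  · exact absurd h.1 h'.1
  · exact absurd h.1 h'.1
  · obtain ⟨w, hw, hw'⟩ := h.1
    rw [cancel hw (h.2.2 w (hw' C rfl)) (h'.2.2 w (hw' C rfl))]
  · exact absurd h'.1 h.2.1
  · exact absurd (vac_BC h') h.2.1
  · exact absurd (vac_C h.1) h'.1
  · exact absurd (vac_C h.1) h'.1
  · exact absurd h.1 h'.2.1
  · obtain ⟨w, hw, hw'⟩ := h.1
    rw [cancel hw (h.2.2 w (hw' C (by simp)) (hw' B (by simp)))
      (h'.2.2 w (hw' C (by simp)) (hw' B (by simp)))]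
  · exact absurd h' h.2.1
  · exact absurd (vac_C (vac_BC h)) h'.1
  · exact absurd (vac_C (vac_BC h)) h'.1
  · exact absurd (vac_BC h) h'.2.1
  · exact absurd h h'.2.1
  · rfl

end UnitarilyEquivToModel

end Uniqueness

/-- Every irreducible `*`-representation of `Pol(Mat₂ˢʸᵐ)_q` by bounded
operators in a (nonzero) complex Hilbert space is unitarily equivalent to exactly one
representation from the list `π⁽¹⁾_{ψ,φ}`, `π⁽²⁾_φ`, `π⁽³⁾_φ`, `π⁽⁴⁾_φ`, `π⁽⁵⁾`. -/
theorem stmt0 (q : ℝ) (hq : q ∈ Set.Ioo (0 : ℝ) 1)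
    {H : Type} [NormedAddCommGroup H] [InnerProductSpace ℂ H] [CompleteSpace H] [Nontrivial H]
    (Z11 Z21 Z22 : H →L[ℂ] H)
    (hrel : PolMat2SymRel q Z11 Z21 Z22)
    (hirr : IsIrreducibleFamily {Z11, Z21, Z22}) :
    ∃! L : RepLabel, UnitarilyEquivToModel q Z11 Z21 Z22 L := by
  have h := hrel.pointwise hq.1.ne'
  obtain ⟨L, hL⟩ := h.exists_label hq hirr
  exact ⟨L, hL, fun L' hL' => UnitarilyEquivToModel.label_unique hq hL' hL⟩
end
end

section
/- Let q ∈ (0,1) and φ ∈ ℝ. On ℓ²(ℤ₊), let Z₁₁ be the unique bounded operator with Z₁₁e_k = q⁻¹√(1−q^{4k+4}) e_{k+1}, let Z₂₁ = 0, and let Z₂₂ = e^{iφ}·I. Then (Z₁₁, Z₂₁, Z₂₂) satisfies the Pol(Mat₂^sym)_q relations. -/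
open ContinuousLinearMap Complex

noncomputable section

/-- Bounded operators on `L2 ι` agreeing on the standard basis are equal. -/
lemma ext_on_basis {ι : Type} [DecidableEq ι] {S T : L2 ι →L[ℂ] L2 ι}
    (h : ∀ i, S (e i) = T (e i)) : S = T := by
  refine lp.ext_continuousLinearMap (by norm_num) fun i ↦ ?_
  ext
  simpa [e] using congrArg (fun v : L2 ι ↦ v _) (h i)

lemma inner_e {ι : Type} [DecidableEq ι] (i : ι) (f : L2 ι) : inner ℂ (e i) f = f i := by
  simp [e, lp.inner_single_left]

lemma e_apply {ι : Type} [DecidableEq ι] (i j : ι) : (e i : L2 ι) j = if j = i then 1 else 0 := by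
  simp [e, Pi.single_apply]

lemma adjoint_weighted_shift_zero (Z : L2 ℕ →L[ℂ] L2 ℕ) (c : ℕ → ℝ)
    (h : ∀ k, Z (e k) = (c k : ℂ) • e (k + 1)) : adjoint Z (e 0) = 0 := by
  ext j
  rw [← inner_e, adjoint_inner_right, h, inner_smul_left, inner_e, e_apply]
  simp

lemma adjoint_weighted_shift_succ (Z : L2 ℕ →L[ℂ] L2 ℕ) (c : ℕ → ℝ)
    (h : ∀ k, Z (e k) = (c k : ℂ) • e (k + 1)) (k : ℕ) :
    adjoint Z (e (k + 1)) = (c k : ℂ) • e k := by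
  ext j
  rw [← inner_e, adjoint_inner_right, h, inner_smul_left, inner_e, e_apply, lp.coeFn_smul,
    Pi.smul_apply, e_apply]
  rcases eq_or_ne j k with rfl | hjk
  · simp
  · simp [hjk]

/-- For `q ∈ (0,1)` and `φ ∈ ℝ`, the operators on `ℓ²(ℤ₊)` given by
`Z₁₁ e_k = q⁻¹√(1−q^{4k+4}) e_{k+1}`, `Z₂₁ = 0`, `Z₂₂ = e^{iφ}·I` satisfy the
`Pol(Mat₂ˢʸᵐ)_q` relations. -/
theorem stmt2 (q : ℝ) (hq : q ∈ Set.Ioo (0 : ℝ) 1) (φ : ℝ)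
    (Z11 : L2 ℕ →L[ℂ] L2 ℕ)
    (h11 : ∀ k : ℕ, Z11 (e k) = ((q⁻¹ * Real.sqrt (1 - q ^ (4 * k + 4)) : ℝ) : ℂ) • e (k + 1)) :
    PolMat2SymRel q Z11 (0 : L2 ℕ →L[ℂ] L2 ℕ)
      (Complex.exp (φ * Complex.I) • (1 : L2 ℕ →L[ℂ] L2 ℕ)) := by
  have hq0 : (q : ℂ) ≠ 0 := by exact_mod_cast hq.1.ne'
  have hphase : adjoint (Complex.exp (φ * Complex.I) • (1 : L2 ℕ →L[ℂ] L2 ℕ))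
      = (Complex.exp (φ * Complex.I))⁻¹ • (1 : L2 ℕ →L[ℂ] L2 ℕ) := by
    rw [map_smulₛₗ, ← star_eq_adjoint, star_one, ← Complex.exp_conj, ← Complex.exp_neg]
    simp
  have hne := Complex.exp_ne_zero (φ * Complex.I)
  have hsq : ∀ k : ℕ, ((q⁻¹ * Real.sqrt (1 - q ^ (4 * k + 4)) : ℝ) : ℂ) ^ 2
      = ((q : ℂ)⁻¹) ^ 2 * (1 - (q : ℂ) ^ (4 * k + 4)) := fun k ↦ by
    have h : (0 : ℝ) ≤ 1 - q ^ (4 * k + 4) :=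
      sub_nonneg.2 (pow_le_one₀ hq.1.le hq.2.le)
    rw [← Complex.ofReal_pow, mul_pow, Real.sq_sqrt h]
    push_cast
    rfl
  have hzero := adjoint_weighted_shift_zero Z11 _ h11
  have hsucc := adjoint_weighted_shift_succ Z11 _ h11
  refine ⟨by simp, by simp, by simp, ?_, by simp, ?_, by simp, ?_, ?_⟩
  · refine ext_on_basis fun k ↦ ?_
    rw [hphase]
    simp only [zero_mul, smul_zero, sub_zero, smul_mul_smul_comm, mul_inv_cancel₀ hne, one_mul,
      one_smul, add_apply, smul_apply, mul_apply_eq_comp, one_apply_eq_self, h11, map_smul, hsucc]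
    cases k with
    | zero =>
      have := hsq 0
      simp only [hzero, map_zero, smul_zero, smul_smul, ← sq, this, ← add_smul, zero_add]
      congr 1
      field_simp
      ring
    | succ k =>
      simp only [hsucc, map_smul, h11, smul_smul, ← sq, hsq, ← add_smul]
      congr 1
      field_simp
      ring
  · simp
  · rw [hphase]
    simp [smul_smul, hne]
  · rw [hphase]
    simp only [smul_mul_smul_comm, mul_inv_cancel₀ hne, inv_mul_cancel₀ hne, one_mul, one_smul,
      ← add_smul, add_sub_cancel]
end
end

section
/- Let q ∈ (0,1) and φ ∈ ℝ. On ℓ²(ℤ₊²), let Z₁₁, Z₂₁, Z₂₂ be the unique bounded operators with Z₁₁e_{k,l} = q^{2k}e^{iφ}e_{k,l} − q⁻¹√((1−q^{4l})(1−q^{2k+2})(1−q^{2k+4})) e_{k+2,l−1} (the second term being 0 when l = 0), Z₂₁e_{k,l} = q^{2l}√(1−q^{2k+2}) e_{k+1,l}, and Z₂₂e_{k,l} = √(1−q^{4l+4}) e_{k,l+1}. Then (Z₁₁, Z₂₁, Z₂₂) satisfies the Pol(Mat₂^sym)_q relations. -/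
open ContinuousLinearMap Complex

noncomputable section

theorem L2.clm_ext {ι : Type} [DecidableEq ι] {A B : L2 ι →L[ℂ] L2 ι}
    (h : ∀ i, A (e i) = B (e i)) : A = B := by
  ext1 f
  have hf := lp.hasSum_single (E := fun _ : ι => ℂ) (p := 2) (by norm_num) f
  have hs : ∀ i, (lp.single 2 i (f i) : L2 ι) = f i • e i := fun i => by
    rw [e, ← lp.single_smul, smul_eq_mul, mul_one]
  simp only [hs] at hf
  refine (hf.mapL A).unique ?_
  simpa [h] using hf.mapL B

theorem L2.inner_e_e {ι : Type} [DecidableEq ι] (i j : ι) :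
    inner ℂ (e i) (e j) = if i = j then (1 : ℂ) else 0 := by
  rw [e, e, lp.inner_single_left]
  by_cases h : i = j
  · subst h; simp
  · simp [h]

theorem L2.vec_ext {ι : Type} [DecidableEq ι] {x y : L2 ι}
    (h : ∀ i, inner ℂ (e i) x = inner ℂ (e i) y) : x = y := by
  ext i
  simpa [e, lp.inner_single_left] using h i

theorem L2.adjoint_apply_e {ι : Type} [DecidableEq ι] {A : L2 ι →L[ℂ] L2 ι} {j : ι} {y : L2 ι}
    (h : ∀ i, inner ℂ (A (e i)) (e j) = inner ℂ (e i) y) : adjoint A (e j) = y :=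
  L2.vec_ext fun i => by rw [adjoint_inner_right, h]

set_option maxHeartbeats 4000000 in
/-- The relations follow from the action on the standard basis once the coefficients are written
through weights `b l`, `c k` with `b l ^ 2 = 1 - q ^ (4 * l)` and `c k ^ 2 = 1 - q ^ (2 * k)`. -/
theorem polMat2SymRel_of_apply_e {q : ℝ} (hq : (q : ℂ) ≠ 0) {w : ℂ} (hw0 : w ≠ 0)
    (hwi : (starRingEnd ℂ) w = w⁻¹) {b c : ℕ → ℝ} (hb0 : b 0 = 0)
    (hb2 : ∀ l, (b l : ℂ) ^ 2 = 1 - (q : ℂ) ^ (4 * l))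
    (hc2 : ∀ k, (c k : ℂ) ^ 2 = 1 - (q : ℂ) ^ (2 * k))
    {Z11 Z21 Z22 : L2 (ℕ × ℕ) →L[ℂ] L2 (ℕ × ℕ)}
    (h11 : ∀ k l : ℕ, Z11 (e (k, l)) = ((q : ℂ) ^ (2 * k) * w) • e (k, l)
      - ((q : ℂ)⁻¹ * b l * c (k + 1) * c (k + 2)) • e (k + 2, l - 1))
    (h21 : ∀ k l : ℕ, Z21 (e (k, l)) = ((q : ℂ) ^ (2 * l) * (c (k + 1) : ℂ)) • e (k + 1, l))
    (h22 : ∀ k l : ℕ, Z22 (e (k, l)) = (b (l + 1) : ℂ) • e (k, l + 1)) :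
    PolMat2SymRel q Z11 Z21 Z22 := by
  have g22z : ∀ k : ℕ, adjoint Z22 (e (k, 0)) = 0 := fun k =>
    L2.adjoint_apply_e fun ⟨i, j⟩ => by simp [h22, L2.inner_e_e]
  have g22 : ∀ k l : ℕ, adjoint Z22 (e (k, l + 1)) = (b (l + 1) : ℂ) • e (k, l) := fun k l =>
    L2.adjoint_apply_e fun ⟨i, j⟩ => by
      simp only [h22, inner_smul_left, inner_smul_right, L2.inner_e_e, Complex.conj_ofReal,
        Prod.mk.injEq, add_left_inj]
      split_ifs <;> simp_all
  have g21z : ∀ l : ℕ, adjoint Z21 (e (0, l)) = 0 := fun k =>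
    L2.adjoint_apply_e fun ⟨i, j⟩ => by simp [h21, L2.inner_e_e]
  have g21 : ∀ k l : ℕ, adjoint Z21 (e (k + 1, l)) =
      ((q : ℂ) ^ (2 * l) * (c (k + 1) : ℂ)) • e (k, l) := fun k l =>
    L2.adjoint_apply_e fun ⟨i, j⟩ => by
      simp only [h21, inner_smul_left, inner_smul_right, L2.inner_e_e, Complex.conj_ofReal,
        Prod.mk.injEq, add_left_inj, map_mul, map_pow]
      split_ifs <;> simp_all
  have g11 : ∀ k l : ℕ, adjoint Z11 (e (k + 2, l)) =
      ((q : ℂ) ^ (2 * (k + 2)) * (starRingEnd ℂ) w) • e (k + 2, l)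
      - ((q : ℂ)⁻¹ * b (l + 1) * c (k + 1) * c (k + 2)) • e (k, l + 1) := fun k l =>
    L2.adjoint_apply_e fun ⟨i, j⟩ => by
      cases j <;>
      simp only [h11, inner_sub_left, inner_sub_right, inner_smul_left, inner_smul_right,
        L2.inner_e_e, Complex.conj_ofReal, Prod.mk.injEq, add_left_inj, map_mul, map_pow,
        map_inv₀, hb0, Nat.add_sub_cancel] <;>
      split_ifs <;> simp_all
  have g11z : ∀ k l : ℕ, k < 2 → adjoint Z11 (e (k, l)) =
      ((q : ℂ) ^ (2 * k) * (starRingEnd ℂ) w) • e (k, l) := fun k l hk =>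
    L2.adjoint_apply_e fun ⟨i, j⟩ => by
      have hk' : i + 2 ≠ k := by omega
      simp only [h11, inner_sub_left, inner_smul_left, inner_smul_right,
        L2.inner_e_e, Complex.conj_ofReal, Prod.mk.injEq, map_mul, map_pow,
        map_inv₀, hk']
      split_ifs <;> simp_all
  have g110 := fun l => g11z 0 l (by norm_num)
  have g111 := fun l => g11z 1 l (by norm_num)
  refine ⟨?_, ?_, ?_, ?_, ?_, ?_, ?_, ?_, ?_⟩ <;>
  · refine L2.clm_ext ?_
    rintro ⟨_ | _ | k, _ | l⟩ <;>
    simp only [mul_apply_eq_comp, add_apply,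
      sub_apply, smul_apply, one_apply_eq_self, map_sub, map_smul,
      map_zero, smul_zero, smul_sub, smul_smul, sub_zero, zero_add, add_zero,
      h22, h21, h11, g22z, g22, g21z, g21, g11, g110, g111, hb0, Nat.add_sub_cancel,
      Complex.ofReal_zero, mul_zero, zero_mul, zero_smul] <;>
    (try simp only [Nat.add_assoc, Nat.reduceAdd, Nat.reduceSub]) <;>
    match_scalars <;>
    (try simp only [pow_add, mul_add, pow_mul', pow_zero, mul_one, one_mul, hwi]) <;>
    first
    | done
    | (field_simp; done)
    | (field_simp; ring1)
    | (field_simp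
       simp only [hb2, hc2, pow_add, mul_add, pow_mul', mul_one] <;> ring1)

/-- For `q ∈ (0,1)` and `φ ∈ ℝ`, the operators on `ℓ²(ℤ₊²)` given by
`Z₁₁ e_{k,l} = q^{2k}e^{iφ} e_{k,l} − q⁻¹√((1−q^{4l})(1−q^{2k+2})(1−q^{2k+4})) e_{k+2,l−1}`
(the second term vanishing when `l = 0`), `Z₂₁ e_{k,l} = q^{2l}√(1−q^{2k+2}) e_{k+1,l}`,
`Z₂₂ e_{k,l} = √(1−q^{4l+4}) e_{k,l+1}` satisfy the `Pol(Mat₂ˢʸᵐ)_q` relations. -/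
theorem stmt4 (q : ℝ) (hq : q ∈ Set.Ioo (0 : ℝ) 1) (φ : ℝ)
    (Z11 Z21 Z22 : L2 (ℕ × ℕ) →L[ℂ] L2 (ℕ × ℕ))
    (h11 : ∀ k l : ℕ, Z11 (e (k, l)) =
      (((q ^ (2 * k) : ℝ) : ℂ) * Complex.exp (φ * Complex.I)) • e (k, l)
      - ((q⁻¹ * Real.sqrt ((1 - q ^ (4 * l)) * (1 - q ^ (2 * k + 2)) * (1 - q ^ (2 * k + 4)))
          : ℝ) : ℂ) • e (k + 2, l - 1))
    (h21 : ∀ k l : ℕ, Z21 (e (k, l)) =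
      ((q ^ (2 * l) * Real.sqrt (1 - q ^ (2 * k + 2)) : ℝ) : ℂ) • e (k + 1, l))
    (h22 : ∀ k l : ℕ, Z22 (e (k, l)) =
      ((Real.sqrt (1 - q ^ (4 * l + 4)) : ℝ) : ℂ) • e (k, l + 1)) :
    PolMat2SymRel q Z11 Z21 Z22 := by
  obtain ⟨hq0, hq1⟩ := hq
  have hqne : (q : ℂ) ≠ 0 := by exact_mod_cast hq0.ne'
  set w : ℂ := Complex.exp (φ * Complex.I) with hw
  have hww : w * (starRingEnd ℂ) w = 1 := by
    rw [Complex.mul_conj, Complex.normSq_eq_norm_sq, hw, Complex.norm_exp_ofReal_mul_I]; simp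
  have hnn : ∀ n : ℕ, 0 ≤ 1 - q ^ n := fun n => sub_nonneg.2 (pow_le_one₀ hq0.le hq1.le)
  obtain ⟨b, hb⟩ : ∃ b : ℕ → ℝ, ∀ l, b l = Real.sqrt (1 - q ^ (4 * l)) := ⟨_, fun _ => rfl⟩
  obtain ⟨c, hc⟩ : ∃ c : ℕ → ℝ, ∀ k, c k = Real.sqrt (1 - q ^ (2 * k)) := ⟨_, fun _ => rfl⟩
  have hb0 : b 0 = 0 := by simp [hb]
  have hb2 : ∀ l, (b l : ℂ) ^ 2 = 1 - (q : ℂ) ^ (4 * l) := fun l => by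
    rw [hb]; exact_mod_cast Real.sq_sqrt (hnn _)
  have hc2 : ∀ k, (c k : ℂ) ^ 2 = 1 - (q : ℂ) ^ (2 * k) := fun k => by
    rw [hc]; exact_mod_cast Real.sq_sqrt (hnn _)
  have h22' : ∀ k l : ℕ, Z22 (e (k, l)) = (b (l + 1) : ℂ) • e (k, l + 1) := fun k l => by
    rw [h22, hb]; rfl
  have h21' : ∀ k l : ℕ, Z21 (e (k, l)) =
      ((q : ℂ) ^ (2 * l) * (c (k + 1) : ℂ)) • e (k + 1, l) := fun k l => by
    rw [h21, hc, mul_add]; push_cast; rfl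
  have h11' : ∀ k l : ℕ, Z11 (e (k, l)) = ((q : ℂ) ^ (2 * k) * w) • e (k, l)
      - ((q : ℂ)⁻¹ * b l * c (k + 1) * c (k + 2)) • e (k + 2, l - 1) := fun k l => by
    rw [h11, hc, hc, hb, Real.sqrt_mul (mul_nonneg (hnn _) (hnn _)), Real.sqrt_mul (hnn _)]
    push_cast
    simp only [mul_add, mul_assoc, mul_one]
  exact polMat2SymRel_of_apply_e hqne (Complex.exp_ne_zero _) (eq_inv_of_mul_eq_one_right hww)
    hb0 hb2 hc2 h11' h21' h22'
end
end

section
/- Let q ∈ (0,1) and let bounded operators Z₁₁, Z₂₁, Z₂₂ on a complex Hilbert space H satisfy the Pol(Mat₂^sym)_q relations. Then (Z₂₁Z₂₁*)·Z₁₁ = Z₁₁·(Z₂₁Z₂₁*) + q(q²−q⁻²)·Z₂₁²Z₂₂*, and (Z₂₂Z₂₂*)·Z₁₁ = Z₁₁·(Z₂₂Z₂₂*) − q(q²−q⁻²)·Z₂₁²Z₂₂*. -/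
open ContinuousLinearMap Complex

noncomputable section

/-- If `Z₁₁, Z₂₁, Z₂₂` satisfy the `Pol(Mat₂ˢʸᵐ)_q` relations, then
`(Z₂₁Z₂₁*)Z₁₁ = Z₁₁(Z₂₁Z₂₁*) + q(q²−q⁻²)Z₂₁²Z₂₂*` and
`(Z₂₂Z₂₂*)Z₁₁ = Z₁₁(Z₂₂Z₂₂*) − q(q²−q⁻²)Z₂₁²Z₂₂*`. -/
theorem stmt12 (q : ℝ) (hq : q ∈ Set.Ioo (0 : ℝ) 1)
    {H : Type} [NormedAddCommGroup H] [InnerProductSpace ℂ H] [CompleteSpace H]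
    (Z11 Z21 Z22 : H →L[ℂ] H) (hrel : PolMat2SymRel q Z11 Z21 Z22) :
    (Z21 * adjoint Z21) * Z11 =
        Z11 * (Z21 * adjoint Z21)
          + ((q : ℂ) * ((q : ℂ) ^ 2 - ((q : ℂ)⁻¹) ^ 2)) • (Z21 * Z21 * adjoint Z22) ∧
    (Z22 * adjoint Z22) * Z11 =
        Z11 * (Z22 * adjoint Z22)
          - ((q : ℂ) * ((q : ℂ) ^ 2 - ((q : ℂ)⁻¹) ^ 2)) • (Z21 * Z21 * adjoint Z22) := by
  obtain ⟨h1, -, h3, -, h5, h6, -, -, -⟩ := hrel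
  have hca : adjoint Z22 * Z11 = Z11 * adjoint Z22 := by
    have h := congrArg star h6
    simpa [star_mul, ← star_eq_adjoint] using h
  have hba : adjoint Z21 * Z11 = (q : ℂ) ^ 2 • (Z11 * adjoint Z21)
      - ((q : ℂ) * ((q : ℂ)⁻¹ - (q : ℂ)) * ((q : ℂ)⁻¹ + (q : ℂ))) • (Z21 * adjoint Z22) := by
    have h := congrArg star h5
    simpa [star_mul, star_sub, star_smul, ← star_eq_adjoint, mul_comm, mul_left_comm] using h
  constructor
  · rw [mul_assoc, hba, mul_sub, mul_smul_comm, mul_smul_comm, ← mul_assoc, ← smul_mul_assoc, ← h1,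
      mul_assoc, ← mul_assoc Z21 Z21, sub_eq_add_neg, ← neg_smul]
    congr 2
    ring
  · rw [mul_assoc, hca, ← mul_assoc, ← mul_assoc, ← smul_mul_assoc, ← h3, sub_mul, sub_sub_cancel]
end
end

section
/- Let q ∈ (0,1) and define the bijective affine maps F₁, F₂ : ℝ² → ℝ² by F₁(x₁,x₂) = (q²x₁ − (1−q²)x₂ + 1 − q², x₂) and F₂(x₁,x₂) = (q⁴x₁, q⁴x₂ + 1 − q⁴). Then F₁ ∘ F₂ = F₂ ∘ F₁, and for all integers m, n ∈ ℤ (using the m-th and n-th iterates of F₁ and F₂ as invertible maps), F₁^m(F₂^n(x₁,x₂)) = (q^{2m}q^{4n}x₁ − q^{4n}(1−q^{2m})(x₂−1), q^{4n}x₂ + 1 − q^{4n}) for all (x₁,x₂) ∈ ℝ². In particular the ℤ²-orbit of (x₁,x₂) under F₁, F₂ is Ω_{x₁,x₂} = {(q^{2m}q^{4n}x₁ − q^{4n}(1−q^{2m})(x₂−1), q^{4n}x₂ + 1−q^{4n}) : m,n ∈ ℤ}. -/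
noncomputable section

/-- The bijective affine map `F₁(x₁,x₂) = (q²x₁ − (1−q²)x₂ + 1 − q², x₂)` of `ℝ²`. -/
def F1 (q : ℝ) (hq : q ≠ 0) : Equiv.Perm (ℝ × ℝ) where
  toFun p := (q ^ 2 * p.1 - (1 - q ^ 2) * p.2 + 1 - q ^ 2, p.2)
  invFun p := ((q ^ 2)⁻¹ * (p.1 + (1 - q ^ 2) * p.2 - (1 - q ^ 2)), p.2)
  left_inv p := by
    have h : q ^ 2 ≠ 0 := pow_ne_zero 2 hq
    refine Prod.ext ?_ rfl
    field_simp
    ring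
  right_inv p := by
    have h : q ^ 2 ≠ 0 := pow_ne_zero 2 hq
    refine Prod.ext ?_ rfl
    field_simp
    ring

/-- The bijective affine map `F₂(x₁,x₂) = (q⁴x₁, q⁴x₂ + 1 − q⁴)` of `ℝ²`. -/
def F2 (q : ℝ) (hq : q ≠ 0) : Equiv.Perm (ℝ × ℝ) where
  toFun p := (q ^ 4 * p.1, q ^ 4 * p.2 + 1 - q ^ 4)
  invFun p := ((q ^ 4)⁻¹ * p.1, (q ^ 4)⁻¹ * (p.2 - 1 + q ^ 4))
  left_inv p := by
    have h : q ^ 4 ≠ 0 := pow_ne_zero 4 hq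
    refine Prod.ext ?_ ?_ <;> field_simp <;> ring
  right_inv p := by
    have h : q ^ 4 ≠ 0 := pow_ne_zero 4 hq
    refine Prod.ext ?_ ?_ <;> field_simp <;> ring

/-- The integer iterates of `F₁` scale `x₁ + x₂ - 1` by `q ^ (2 * m)` and fix `x₂`. -/
theorem F1_zpow_apply (q : ℝ) (hq : q ≠ 0) (m : ℤ) (x₁ x₂ : ℝ) :
    (F1 q hq ^ m) (x₁, x₂) = (q ^ (2 * m) * x₁ - (1 - q ^ (2 * m)) * (x₂ - 1), x₂) := by
  induction m generalizing x₁ with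
  | zero => simp
  | succ k ih =>
    have e : q ^ (2 * ((k : ℤ) + 1)) = q ^ (2 * (k : ℤ)) * q ^ 2 := by
      rw [mul_add, zpow_add₀ hq]; rfl
    have h : F1 q hq (x₁, x₂) = (q ^ 2 * x₁ - (1 - q ^ 2) * x₂ + 1 - q ^ 2, x₂) := rfl
    rw [zpow_add_one, Equiv.Perm.mul_apply, h, ih, e]
    refine Prod.ext ?_ rfl
    ring
  | pred k ih =>
    have e : q ^ (2 * (-(k : ℤ) - 1)) = q ^ (2 * -(k : ℤ)) * (q ^ 2)⁻¹ := by
      rw [mul_sub, zpow_sub₀ hq, div_eq_mul_inv]; rfl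
    have h : (F1 q hq)⁻¹ (x₁, x₂) =
        ((q ^ 2)⁻¹ * (x₁ + (1 - q ^ 2) * x₂ - (1 - q ^ 2)), x₂) := rfl
    rw [zpow_sub_one, Equiv.Perm.mul_apply, h, ih, e]
    refine Prod.ext ?_ rfl
    field_simp
    ring

/-- The integer iterates of `F₂` scale `x₁` and `x₂ - 1` by `q ^ (4 * n)`. -/
theorem F2_zpow_apply (q : ℝ) (hq : q ≠ 0) (n : ℤ) (x₁ x₂ : ℝ) :
    (F2 q hq ^ n) (x₁, x₂) = (q ^ (4 * n) * x₁, q ^ (4 * n) * x₂ + 1 - q ^ (4 * n)) := by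
  induction n generalizing x₁ x₂ with
  | zero => simp
  | succ k ih =>
    have e : q ^ (4 * ((k : ℤ) + 1)) = q ^ (4 * (k : ℤ)) * q ^ 4 := by
      rw [mul_add, zpow_add₀ hq]; rfl
    have h : F2 q hq (x₁, x₂) = (q ^ 4 * x₁, q ^ 4 * x₂ + 1 - q ^ 4) := rfl
    rw [zpow_add_one, Equiv.Perm.mul_apply, h, ih, e]
    refine Prod.ext ?_ ?_ <;> ring
  | pred k ih =>
    have e : q ^ (4 * (-(k : ℤ) - 1)) = q ^ (4 * -(k : ℤ)) * (q ^ 4)⁻¹ := by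
      rw [mul_sub, zpow_sub₀ hq, div_eq_mul_inv]; rfl
    have h : (F2 q hq)⁻¹ (x₁, x₂) = ((q ^ 4)⁻¹ * x₁, (q ^ 4)⁻¹ * (x₂ - 1 + q ^ 4)) := rfl
    have h4 : (q ^ 4)⁻¹ * q ^ 4 = 1 := inv_mul_cancel₀ (pow_ne_zero 4 hq)
    rw [zpow_sub_one, Equiv.Perm.mul_apply, h, ih, e]
    refine Prod.ext ?_ ?_
    · ring
    · linear_combination q ^ (4 * -(k : ℤ)) * h4

/-- The maps `F₁` and `F₂` commute. -/
theorem F1_mul_F2 (q : ℝ) (hq : q ≠ 0) : F1 q hq * F2 q hq = F2 q hq * F1 q hq := by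
  ext p
  · change q ^ 2 * (q ^ 4 * p.1) - (1 - q ^ 2) * (q ^ 4 * p.2 + 1 - q ^ 4) + 1 - q ^ 2 =
      q ^ 4 * (q ^ 2 * p.1 - (1 - q ^ 2) * p.2 + 1 - q ^ 2)
    ring
  · rfl

/-- The explicit formula for `F₁^m ∘ F₂^n`. -/
theorem F1_zpow_F2_zpow_apply (q : ℝ) (hq : q ≠ 0) (m n : ℤ) (x₁ x₂ : ℝ) :
    (F1 q hq ^ m) ((F2 q hq ^ n) (x₁, x₂)) =
      (q ^ (2 * m) * q ^ (4 * n) * x₁ - q ^ (4 * n) * (1 - q ^ (2 * m)) * (x₂ - 1),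
        q ^ (4 * n) * x₂ + 1 - q ^ (4 * n)) := by
  rw [F2_zpow_apply, F1_zpow_apply]
  refine Prod.ext ?_ rfl
  ring

/-- The maps `F₁` and `F₂` commute; the iterate
`F₁^m ∘ F₂^n` (for `m, n ∈ ℤ`) is given by the explicit affine formula
`(x₁,x₂) ↦ (q^{2m}q^{4n}x₁ − q^{4n}(1−q^{2m})(x₂−1), q^{4n}x₂ + 1 − q^{4n})`; and hence the
`ℤ²`-orbit of `(x₁,x₂)` is the set `Ω_{x₁,x₂}`. -/
theorem stmt13 (q : ℝ) (hq : q ∈ Set.Ioo (0 : ℝ) 1) :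
    (F1 q (ne_of_gt hq.1)) * (F2 q (ne_of_gt hq.1))
        = (F2 q (ne_of_gt hq.1)) * (F1 q (ne_of_gt hq.1)) ∧
    (∀ (m n : ℤ) (x₁ x₂ : ℝ),
      ((F1 q (ne_of_gt hq.1)) ^ m) (((F2 q (ne_of_gt hq.1)) ^ n) (x₁, x₂)) =
        (q ^ (2 * m) * q ^ (4 * n) * x₁ - q ^ (4 * n) * (1 - q ^ (2 * m)) * (x₂ - 1),
          q ^ (4 * n) * x₂ + 1 - q ^ (4 * n))) ∧
    (∀ x₁ x₂ : ℝ,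
      {p : ℝ × ℝ | ∃ m n : ℤ,
          p = ((F1 q (ne_of_gt hq.1)) ^ m) (((F2 q (ne_of_gt hq.1)) ^ n) (x₁, x₂))} =
        {p : ℝ × ℝ | ∃ m n : ℤ,
          p = (q ^ (2 * m) * q ^ (4 * n) * x₁ - q ^ (4 * n) * (1 - q ^ (2 * m)) * (x₂ - 1),
            q ^ (4 * n) * x₂ + 1 - q ^ (4 * n))}) := by
  refine ⟨F1_mul_F2 q _, F1_zpow_F2_zpow_apply q _, fun x₁ x₂ => ?_⟩
  simp only [F1_zpow_F2_zpow_apply]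
end
end

section
/- Let q ∈ (0,1) and φ ∈ ℝ. On ℓ²(ℤ₊), let Z₁₁ be the unique bounded operator with Z₁₁e_k = q⁻¹√(1−q^{4k+4}) e_{k+1}, let Z₂₁ = 0, and let Z₂₂ = e^{iφ}·I. Then this triple is irreducible: every bounded operator on ℓ²(ℤ₊) commuting with Z₁₁, Z₂₁, Z₂₂ and their adjoints is a scalar multiple of the identity. -/
open ContinuousLinearMap Complex

noncomputable section

/-- A bounded operator commuting with a weighted shift with nonzero weights and with its adjoint
is a scalar multiple of the identity. -/
theorem exists_eq_smul_one_of_commute_weightedShift {S T : L2 ℕ →L[ℂ] L2 ℕ} {w : ℕ → ℂ}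
    (hw : ∀ k, w k ≠ 0) (hS : ∀ k, S (e k) = w k • e (k + 1))
    (hTS : T * S = S * T) (hTS' : T * adjoint S = adjoint S * T) :
    ∃ c : ℂ, T = c • (1 : L2 ℕ →L[ℂ] L2 ℕ) := by
  have inner_e (k : ℕ) (f : L2 ℕ) : inner ℂ (e k) f = f k := by
    simp [e, lp.inner_single_left]
  have adjoint_apply (k : ℕ) (f : L2 ℕ) : adjoint S f k = star (w k) * f (k + 1) := by
    rw [← inner_e, adjoint_inner_right, hS, inner_smul_left, inner_e]
    rfl
  have adjoint_e_zero : adjoint S (e 0) = 0 := by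
    ext k
    rw [adjoint_apply]
    simp [e]
  have apply_e_zero : T (e 0) = T (e 0) 0 • e 0 := by
    ext k
    cases k with
    | zero => simp [e]
    | succ k =>
      have h : adjoint S (T (e 0)) = 0 := by
        simpa [adjoint_e_zero] using (DFunLike.congr_fun hTS' (e 0)).symm
      have hk := adjoint_apply k (T (e 0))
      rw [h] at hk
      have hz : T (e 0) (k + 1) = 0 := by simpa [hw k] using hk.symm
      rw [hz]
      simp [e]
  have apply_e (k : ℕ) : T (e k) = T (e 0) 0 • e k := by
    induction k with
    | zero => exact apply_e_zero
    | succ k ih =>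
      have h : T (S (e k)) = S (T (e k)) := DFunLike.congr_fun hTS (e k)
      rw [ih, map_smul, hS, map_smul, smul_comm] at h
      exact smul_right_injective _ (hw k) h
  refine ⟨T (e 0) 0, ?_⟩
  refine lp.ext_continuousLinearMap (by simp) fun k => ?_
  ext1
  exact apply_e k

/-- The representation `π⁽²⁾_φ` on `ℓ²(ℤ₊)`, given by
`Z₁₁ e_k = q⁻¹√(1−q^{4k+4}) e_{k+1}`, `Z₂₁ = 0`, `Z₂₂ = e^{iφ}·I`, is irreducible. -/
theorem stmt19 (q : ℝ) (hq : q ∈ Set.Ioo (0 : ℝ) 1) (φ : ℝ)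
    (Z11 : L2 ℕ →L[ℂ] L2 ℕ)
    (h11 : ∀ k : ℕ, Z11 (e k) = ((q⁻¹ * Real.sqrt (1 - q ^ (4 * k + 4)) : ℝ) : ℂ) • e (k + 1)) :
    IsIrreducibleFamily
      {Z11, (0 : L2 ℕ →L[ℂ] L2 ℕ), Complex.exp (φ * Complex.I) • (1 : L2 ℕ →L[ℂ] L2 ℕ)} := by
  intro T hT
  obtain ⟨h, h'⟩ := hT Z11 (by simp)
  refine exists_eq_smul_one_of_commute_weightedShift (fun k => ?_) h11 h h'
  have hpow : q ^ (4 * k + 4) < 1 := pow_lt_one₀ hq.1.le hq.2 (by omega)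
  exact_mod_cast (mul_pos (inv_pos.2 hq.1) (Real.sqrt_pos.2 (sub_pos.2 hpow))).ne'
end
end
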